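/- arXiv:1612.07048 — 3 statements merged into one kernel-verified Lean document; each statement's English description precedes it below -/
import Mathlib

section
/- For positive integers n and d, let P_{n,2d} ⊆ ℝ^N (with N = C(n+2d−1, n−1)) denote the cone of coefficient vectors of homogeneous polynomials f of degree 2d in x_1, …, x_n satisfying f(ξ) ≥ 0 for all ξ ∈ ℝ^n. Then P_{n,2d} is a spectrahedral shadow if and only if 2d = 2, or n ≤ 2, or (n, 2d) = (3, 4). -/
/-- A set `K ⊆ ℝ^k` is a spectrahedral shadow if it is the feasible-region projection of a
symmetric linear matrix inequality. -/
def IsSpectrahedralShadow {k : ℕ} (K : Set (Fin k → ℝ)) : Prop :=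
  ∃ (d m : ℕ), 0 < d ∧ ∃ (A : Matrix (Fin d) (Fin d) ℝ)
    (B : Fin k → Matrix (Fin d) (Fin d) ℝ) (C : Fin m → Matrix (Fin d) (Fin d) ℝ),
    A.IsSymm ∧ (∀ i, (B i).IsSymm) ∧ (∀ j, (C j).IsSymm) ∧
    K = {ξ | ∃ η : Fin m → ℝ, (A + ∑ i, ξ i • B i + ∑ j, η j • C j).PosSemidef}

/-- A set `S ⊆ ℝ^n` is semialgebraic: a finite union of sets given by one polynomial
equation and finitely many strict polynomial inequalities. -/
def IsSemialgebraic {n : ℕ} (S : Set (Fin n → ℝ)) : Prop :=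
  ∃ (r : ℕ) (p : Fin r → MvPolynomial (Fin n) ℝ) (s : Fin r → ℕ)
    (q : (i : Fin r) → Fin (s i) → MvPolynomial (Fin n) ℝ),
    S = ⋃ i, {ξ | MvPolynomial.eval ξ (p i) = 0 ∧ ∀ j, 0 < MvPolynomial.eval ξ (q i j)}

theorem exists_algHom_lift_of_isTranscendenceBasis {K L A ι : Type*} [Field K] [CharZero K]
    [Field L] [Algebra K L] [CommRing A] [Algebra K A] {v : ι → L}
    (hv : IsTranscendenceBasis K v) (π : A →+* L)
    (hπK : ∀ k, π (algebraMap K A k) = algebraMap K L k)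
    (hπ : Function.Surjective π) (hnil : IsNilpotent (RingHom.ker π))
    (a : ι → A) (ha : ∀ i, π (a i) = v i) :
    ∃ τ : L →+* A, (∀ k, τ (algebraMap K L k) = algebraMap K A k) ∧ ∀ i, τ (v i) = a i := by
  have hind := hv.1
  have hunit : ∀ y : nonZeroDivisors (MvPolynomial ι K),
      IsUnit ((MvPolynomial.aeval a : MvPolynomial ι K →ₐ[K] A).toRingHom y) := by
    intro y
    have hy : (y : MvPolynomial ι K) ≠ 0 := nonZeroDivisors.ne_zero y.2
    have h1 : π (MvPolynomial.aeval a (y : MvPolynomial ι K)) =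
        MvPolynomial.aeval v (y : MvPolynomial ι K) := by
      have : π.comp (MvPolynomial.aeval a : MvPolynomial ι K →ₐ[K] A).toRingHom =
          (MvPolynomial.aeval v : MvPolynomial ι K →ₐ[K] L).toRingHom := by
        apply MvPolynomial.ringHom_ext
        · intro r; simp [hπK]
        · intro i; simp [ha]
      exact congrArg (fun f => f (y : MvPolynomial ι K)) this
    have h2 : MvPolynomial.aeval v (y : MvPolynomial ι K) ≠ 0 := fun h =>
      hy ((injective_iff_map_eq_zero _).1 hind _ h)
    obtain ⟨b, hb⟩ := hπ (MvPolynomial.aeval v (y : MvPolynomial ι K))⁻¹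
    have h3 : MvPolynomial.aeval a (y : MvPolynomial ι K) * b - 1 ∈ RingHom.ker π := by
      rw [RingHom.mem_ker, map_sub, map_mul, h1, hb, mul_inv_cancel₀ h2, map_one, sub_self]
    obtain ⟨n, hn⟩ := hnil
    have h4 : IsNilpotent (MvPolynomial.aeval a (y : MvPolynomial ι K) * b - 1) := by
      refine ⟨n, ?_⟩
      have := Ideal.pow_mem_pow h3 n
      rw [hn] at this
      simpa using this
    have h5 := h4.isUnit_add_one
    rw [sub_add_cancel] at h5
    exact isUnit_of_mul_isUnit_left h5
  let φ : FractionRing (MvPolynomial ι K) →+* A := IsLocalization.lift hunit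
  have hφ : ∀ p : MvPolynomial ι K,
      φ (algebraMap _ _ p) = MvPolynomial.aeval a p := fun p => IsLocalization.lift_eq hunit p
  let e := hind.aevalEquivField
  have he : ∀ p : MvPolynomial ι K,
      ((e (algebraMap _ _ p) : IntermediateField.adjoin K (Set.range v)) : L)
      = MvPolynomial.aeval v p := fun p => by
    simp [e]
  let ψ : IntermediateField.adjoin K (Set.range v) →+* A := φ.comp e.symm.toRingEquiv.toRingHom
  have hψ : ∀ p, ψ (e p) = φ p := fun p => by simp [ψ]
  let : Algebra (IntermediateField.adjoin K (Set.range v)) A := ψ.toAlgebra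
  have hcomm : ∀ z, π (ψ z) = (z : L) := by
    have : (π.comp φ) = (algebraMap (IntermediateField.adjoin K (Set.range v)) L).comp
        e.toRingEquiv.toRingHom := by
      apply IsLocalization.ringHom_ext (nonZeroDivisors (MvPolynomial ι K))
      apply MvPolynomial.ringHom_ext
      · intro r
        have := he (MvPolynomial.C r)
        simp only [RingHom.comp_apply, hφ]
        rw [show (MvPolynomial.aeval a) (MvPolynomial.C r) = algebraMap K A r by simp, hπK]
        refine Eq.trans ?_ this.symm
        simp
      · intro i
        have := he (MvPolynomial.X i)
        simp only [RingHom.comp_apply, hφ]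
        rw [MvPolynomial.aeval_X, ha]
        refine Eq.trans ?_ this.symm
        simp
    intro z
    obtain ⟨p, rfl⟩ := e.surjective z
    rw [hψ]
    exact congrArg (fun f => f p) this
  let π' : A →ₐ[IntermediateField.adjoin K (Set.range v)] L :=
    { π with commutes' := hcomm }
  have := hv.isAlgebraic_field
  have : CharZero (IntermediateField.adjoin K (Set.range v)) :=
    charZero_of_injective_algebraMap (algebraMap K _).injective
  have := Algebra.FormallyEtale.of_isSeparable (IntermediateField.adjoin K (Set.range v)) L
  let τ := Algebra.FormallySmooth.liftOfSurjective
    (AlgHom.id (IntermediateField.adjoin K (Set.range v)) L) π' hπ hnil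
  have hτ : ∀ p : MvPolynomial ι K, τ (MvPolynomial.aeval v p) = MvPolynomial.aeval a p := by
    intro p
    rw [← he]
    refine Eq.trans (τ.commutes (e (algebraMap _ _ p))) ?_
    change ψ _ = _
    rw [hψ, hφ]
  refine ⟨τ.toRingHom, fun k => ?_, fun i => ?_⟩
  · simpa using hτ (MvPolynomial.C k)
  · simpa using hτ (MvPolynomial.X i)

theorem exists_taylor_ringHom {S : Set ℝ} (hS : S.Countable) (m D : ℕ) :
    ∃ (x : Fin m → ℝ)
      (τ : ℝ →+* MvPolynomial (Fin m) ℝ ⧸ (MvPolynomial.idealOfVars (Fin m) ℝ) ^ D),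
      (∀ s ∈ S, τ s = Ideal.Quotient.mk _ (MvPolynomial.C s)) ∧
      ∀ i, τ (x i) = Ideal.Quotient.mk _ (MvPolynomial.C (x i) + MvPolynomial.X i) := by
  rcases Nat.eq_zero_or_pos D with rfl | hD
  · have : Subsingleton (MvPolynomial (Fin m) ℝ ⧸ (MvPolynomial.idealOfVars (Fin m) ℝ) ^ 0) :=
      Ideal.Quotient.subsingleton_iff.2 (by simp)
    refine ⟨0, (Ideal.Quotient.mk _).comp MvPolynomial.C, fun _ _ => Subsingleton.elim _ _,
      fun _ => Subsingleton.elim _ _⟩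
  let K := Subfield.closure S
  have hK : Cardinal.mk K ≤ Cardinal.aleph0 :=
    (Subfield.cardinalMk_closure_le_max S).trans (max_le hS.le_aleph0 le_rfl)
  obtain ⟨s, hs⟩ := exists_isTranscendenceBasis K ℝ
  have hinf : Infinite s := by
    by_contra hfin
    rw [not_infinite_iff_finite] at hfin
    have h1 : Cardinal.mk (MvPolynomial s K) ≤ Cardinal.aleph0 := by
      have := @MvPolynomial.cardinalMk_le_max s K _
      exact this.trans (max_le (max_le hK Cardinal.mk_le_aleph0) le_rfl)
    have h2 : Cardinal.mk (Algebra.adjoin K (Set.range ((↑) : s → ℝ))) ≤ Cardinal.aleph0 :=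
      (Cardinal.mk_le_of_injective hs.1.aevalEquiv.symm.injective).trans h1
    have := hs.isAlgebraic
    have h3 := Algebra.IsAlgebraic.cardinalMk_le_max (Algebra.adjoin K (Set.range ((↑) : s → ℝ))) ℝ
    rw [Cardinal.mk_real] at h3
    exact absurd (h3.trans (max_le h2 le_rfl)) (not_le.2 Cardinal.aleph0_lt_continuum)
  let g : Fin m ↪ s := (Fin.valEmbedding).trans (Infinite.natEmbedding s)
  let I := MvPolynomial.idealOfVars (Fin m) ℝ
  let ev : MvPolynomial (Fin m) ℝ →+* ℝ := MvPolynomial.constantCoeff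
  have hker : RingHom.ker ev = I := by
    ext p
    have := MvPolynomial.mem_pow_idealOfVars_iff' 1 p
    rw [pow_one] at this
    change _ ↔ p ∈ MvPolynomial.idealOfVars (Fin m) ℝ
    rw [this, RingHom.mem_ker]
    simp only [Nat.lt_one_iff, Finsupp.degree_eq_zero_iff]
    simp [ev, MvPolynomial.constantCoeff_eq]
  let π : MvPolynomial (Fin m) ℝ ⧸ I ^ D →+* ℝ := Ideal.Quotient.lift (I ^ D) ev (by
    intro p hp
    have : p ∈ I := Ideal.pow_le_self hD.ne' hp
    rw [← hker] at this
    exact this)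
  have hπ : ∀ p, π (Ideal.Quotient.mk _ p) = ev p := fun p => rfl
  classical
  let a : s → MvPolynomial (Fin m) ℝ ⧸ I ^ D := fun t =>
    Ideal.Quotient.mk _ (MvPolynomial.C (t : ℝ) +
      if h : ∃ i, g i = t then MvPolynomial.X h.choose else 0)
  obtain ⟨τ, h1, h2⟩ := exists_algHom_lift_of_isTranscendenceBasis hs π (fun k => by
      change π (Ideal.Quotient.mk _ (MvPolynomial.C (k : ℝ))) = _
      rw [hπ]; simp [ev]; rfl)
    (fun r => ⟨Ideal.Quotient.mk _ (MvPolynomial.C r), by rw [hπ]; simp [ev]⟩)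
    ⟨D, by
      rw [Ideal.zero_eq_bot, eq_bot_iff, ← Ideal.map_mk_eq_bot_of_le (le_refl (I ^ D)),
        Ideal.map_pow]
      apply Ideal.pow_right_mono
      intro z hz
      obtain ⟨p, rfl⟩ := Ideal.Quotient.mk_surjective z
      rw [RingHom.mem_ker, hπ, ← RingHom.mem_ker, hker] at hz
      exact Ideal.mem_map_of_mem _ hz⟩
    a (fun t => by
      simp only [a, hπ, map_add]
      split_ifs <;> simp [ev])
  refine ⟨fun i => g i, τ, fun r hr => ?_, fun i => ?_⟩
  · exact h1 ⟨r, Subfield.subset_closure hr⟩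
  · rw [h2]
    have h : ∃ j, g j = g i := ⟨i, rfl⟩
    simp only [a]
    rw [dif_pos h, g.injective h.choose_spec]

open Matrix in
theorem Matrix.posSemidef_real_iff {ι : Type*} [Fintype ι] {M : Matrix ι ι ℝ} :
    M.PosSemidef ↔ Mᵀ = M ∧ ∀ v : ι → ℝ, 0 ≤ v ⬝ᵥ (M *ᵥ v) := by
  rw [Matrix.posSemidef_iff_dotProduct_mulVec]
  simp [Matrix.IsHermitian]

open scoped MatrixOrder Matrix.Norms.L2Operator in
theorem Matrix.PosSemidef.exists_eq_transpose_mul_self {ι : Type*} [Fintype ι] [DecidableEq ι]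
    {M : Matrix ι ι ℝ} (hM : M.PosSemidef) : ∃ B : Matrix ι ι ℝ, M = B.transpose * B := by
  obtain ⟨B, hB⟩ := CStarAlgebra.nonneg_iff_eq_star_mul_self.mp hM.nonneg
  exact ⟨B, by simpa [Matrix.star_eq_conjTranspose] using hB⟩

theorem Matrix.PosSemidef.trace_mul_nonneg {ι : Type*} [Fintype ι] [DecidableEq ι]
    {M N : Matrix ι ι ℝ} (hM : M.PosSemidef) (hN : N.PosSemidef) : 0 ≤ (M * N).trace := by
  obtain ⟨B, rfl⟩ := hM.exists_eq_transpose_mul_self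
  rw [Matrix.mul_assoc, Matrix.trace_mul_comm]
  exact (hN.mul_mul_conjTranspose_same B).trace_nonneg

/-- The orthogonal projection onto the range of a positive semidefinite matrix. -/
theorem Matrix.PosSemidef.exists_projection {ι : Type*} [Fintype ι] [DecidableEq ι]
    {M : Matrix ι ι ℝ} (hM : M.PosSemidef) :
    ∃ (E : Matrix ι ι ℝ) (δ : ℝ), 0 < δ ∧ E.transpose = E ∧ E * E = E ∧ M * E = M ∧
      (M - δ • E).PosSemidef := by
  have hH := hM.1
  set lam := hH.eigenvalues with hlam
  set U : Matrix ι ι ℝ := (hH.eigenvectorUnitary : Matrix ι ι ℝ) with hU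
  have hUU : U.transpose * U = 1 := by
    have := Unitary.coe_star_mul_self hH.eigenvectorUnitary
    simpa [Matrix.star_eq_conjTranspose] using this
  have hspec : M = U * diagonal lam * U.transpose := by
    have := hH.spectral_theorem
    rw [Unitary.conjStarAlgAut_apply] at this
    simpa [Matrix.star_eq_conjTranspose] using this
  have hmul : ∀ a b : ι → ℝ, (U * diagonal a * U.transpose) * (U * diagonal b * U.transpose) =
      U * diagonal (fun i => a i * b i) * U.transpose := by
    intro a b
    rw [← Matrix.diagonal_mul_diagonal]
    calc _ = U * diagonal a * (U.transpose * U) * diagonal b * U.transpose := by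
          simp only [Matrix.mul_assoc]
      _ = _ := by rw [hUU, Matrix.mul_one]; simp only [Matrix.mul_assoc]
  obtain ⟨δ, hδ, hδl⟩ : ∃ δ : ℝ, 0 < δ ∧ ∀ i, lam i ≠ 0 → δ ≤ lam i := by
    rcases (Finset.univ.filter fun i => lam i ≠ 0).eq_empty_or_nonempty with h | h
    · refine ⟨1, one_pos, fun i hi => ?_⟩
      have : i ∈ Finset.univ.filter fun i => lam i ≠ 0 := by simp [hi]
      simp [h] at this
    · obtain ⟨i, hi, hmin⟩ := Finset.exists_min_image _ lam h
      refine ⟨lam i, ?_, fun j hj => hmin j (by simpa using hj)⟩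
      exact lt_of_le_of_ne (hM.eigenvalues_nonneg i)
        (by simpa using (Finset.mem_filter.1 hi).2.symm)
  set a : ι → ℝ := fun i => if lam i = 0 then 0 else 1
  refine ⟨U * diagonal a * U.transpose, δ, hδ, ?_, ?_, ?_, ?_⟩
  · simp [Matrix.mul_assoc]
  · rw [hmul]; congr; ext i; simp only [a]; split_ifs <;> simp
  · conv_lhs => rw [hspec]
    conv_rhs => rw [hspec]
    rw [hmul]; congr; ext i; simp only [a]; split_ifs with h <;> simp [h]
  · have : M - δ • (U * diagonal a * U.transpose) =
        U * diagonal (fun i => lam i - δ * a i) * U.transpose := by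
      conv_lhs => rw [hspec]
      rw [← Matrix.smul_mul, ← Matrix.mul_smul, ← Matrix.sub_mul, ← Matrix.mul_sub,
        ← Matrix.diagonal_smul, Matrix.diagonal_sub]
      rfl
    rw [this]
    refine Matrix.PosSemidef.mul_mul_conjTranspose_same (Matrix.PosSemidef.diagonal ?_) U
    intro i
    simp only [a, Pi.zero_apply]
    split_ifs with h
    · simp [h]
    · have := hδl i h; linarith

/-- A convex cone of positive semidefinite matrices contains an element of maximal range. -/
theorem exists_maximal_range_posSemidef {ι : Type*} [Fintype ι] [DecidableEq ι]
    (𝒞 : Set (Matrix ι ι ℝ)) (h0 : 0 ∈ 𝒞) (hadd : ∀ M ∈ 𝒞, ∀ N ∈ 𝒞, M + N ∈ 𝒞)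
    (hpsd : ∀ M ∈ 𝒞, M.PosSemidef) :
    ∃ M₀ ∈ 𝒞, ∃ (E : Matrix ι ι ℝ) (δ : ℝ), 0 < δ ∧ E.transpose = E ∧ E * E = E ∧
      (M₀ - δ • E).PosSemidef ∧ ∀ M ∈ 𝒞, M * E = M := by
  obtain ⟨M₀, hM₀, hmin⟩ : ∃ M₀ ∈ 𝒞, ∀ M ∈ 𝒞,
      Module.finrank ℝ (LinearMap.ker M₀.mulVecLin) ≤
        Module.finrank ℝ (LinearMap.ker M.mulVecLin) := by
    have hne : (Set.Nonempty 𝒞) := ⟨0, h0⟩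
    obtain ⟨M₀, h1, h2⟩ := WellFounded.has_min
      (measure fun M : Matrix ι ι ℝ => Module.finrank ℝ (LinearMap.ker M.mulVecLin)).wf 𝒞 hne
    exact ⟨M₀, h1, fun M hM => not_lt.1 (h2 M hM)⟩
  have hker : ∀ M ∈ 𝒞, ∀ v, M₀.mulVec v = 0 → M.mulVec v = 0 := by
    intro M hM
    have hsum : ∀ v, (M₀ + M).mulVec v = 0 → M₀.mulVec v = 0 ∧ M.mulVec v = 0 := by
      intro v hv
      have h1 := (hpsd _ hM₀).dotProduct_mulVec_nonneg v
      have h2 := (hpsd _ hM).dotProduct_mulVec_nonneg v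
      have h3 : star v ⬝ᵥ (M₀ + M).mulVec v = 0 := by rw [hv]; simp
      rw [Matrix.add_mulVec, dotProduct_add] at h3
      exact ⟨((hpsd _ hM₀).dotProduct_mulVec_zero_iff v).1 (by linarith),
        ((hpsd _ hM).dotProduct_mulVec_zero_iff v).1 (by linarith)⟩
    have hle : LinearMap.ker (M₀ + M).mulVecLin ≤ LinearMap.ker M₀.mulVecLin := by
      intro v hv
      simp only [LinearMap.mem_ker, Matrix.mulVecLin_apply] at hv ⊢
      exact (hsum v hv).1
    have heq := Submodule.eq_of_le_of_finrank_le hle (hmin _ (hadd _ hM₀ _ hM))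
    intro v hv
    have : v ∈ LinearMap.ker M₀.mulVecLin := by simpa using hv
    rw [← heq] at this
    exact (hsum v this).2
  obtain ⟨E, δ, hδ, hET, hEE, hME, hpos⟩ := (hpsd _ hM₀).exists_projection
  refine ⟨M₀, hM₀, E, δ, hδ, hET, hEE, hpos, fun M hM => ?_⟩
  have : M * (1 - E) = 0 := by
    apply Matrix.ext_of_mulVec_single
    intro i
    rw [← Matrix.mulVec_mulVec, Matrix.zero_mulVec]
    apply hker M hM
    rw [Matrix.mulVec_mulVec, Matrix.mul_sub, Matrix.mul_one, hME, sub_self, Matrix.zero_mulVec]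
  rw [Matrix.mul_sub, Matrix.mul_one, sub_eq_zero] at this
  exact this.symm

/-- Conic duality: linear functionals that are nonnegative on a spectrahedral cone are represented
by positive semidefinite matrices on the smallest face of the cone. -/
theorem exists_posSemidef_dual {ι L X : Type*} [Fintype ι] [DecidableEq ι] [AddCommGroup L]
    [Module ℝ L] (Q : L →ₗ[ℝ] Matrix ι ι ℝ) (hsym : ∀ z, (Q z).transpose = Q z)
    (ev : X → L →ₗ[ℝ] ℝ) (hev : ∀ x z, (Q z).PosSemidef → 0 ≤ ev x z) :
    ∃ Λ : Submodule ℝ L, (∀ z, (Q z).PosSemidef → z ∈ Λ) ∧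
      ∀ x, ∃ Z : Matrix ι ι ℝ, Z.PosSemidef ∧ ∀ z ∈ Λ, (Q z * Z).trace = ev x z := by
  obtain ⟨M₀, ⟨hM₀p, z₀, hz₀⟩, E, δ, hδ, hET, hEE, hpos, hE⟩ :=
    exists_maximal_range_posSemidef {M : Matrix ι ι ℝ | M.PosSemidef ∧ ∃ z, Q z = M}
      ⟨Matrix.PosSemidef.zero, 0, by simp⟩
      (fun M hM N hN => ⟨hM.1.add hN.1, by
        obtain ⟨z, hz⟩ := hM.2; obtain ⟨w, hw⟩ := hN.2; exact ⟨z + w, by rw [map_add, hz, hw]⟩⟩)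
      (fun M hM => hM.1)
  subst hz₀
  let Λ : Submodule ℝ L :=
    { carrier := {z | Q z * E = Q z}
      add_mem' := fun {a b} ha hb => by
        simp only [Set.mem_ofPred_eq] at *; rw [map_add, Matrix.add_mul, ha, hb]
      zero_mem' := by simp
      smul_mem' := fun c z hz => by
        simp only [Set.mem_ofPred_eq] at *; rw [map_smul, Matrix.smul_mul, hz] }
  have hΛ : ∀ z, (Q z).PosSemidef → z ∈ Λ := fun z hz => hE _ ⟨hz, z, rfl⟩
  have hΛ2 : ∀ z ∈ Λ, E * Q z * E = Q z := by
    intro z hz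
    have h1 : Q z * E = Q z := hz
    have h2 := congrArg Matrix.transpose h1
    rw [Matrix.transpose_mul, hET, hsym] at h2
    rw [h2, h1]
  refine ⟨Λ, hΛ, fun x => ?_⟩
  let s : PointedCone ℝ (Matrix ι ι ℝ) :=
    { carrier := {Y | ∀ v : ι → ℝ, 0 ≤ v ⬝ᵥ ((E * Y * E).mulVec v)}
      add_mem' := fun {a b} ha hb v => by
        have := add_nonneg (ha v) (hb v)
        rwa [← dotProduct_add, ← Matrix.add_mulVec, ← Matrix.add_mul, ← Matrix.mul_add] at this
      zero_mem' := by simp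
      smul_mem' := fun c Y hY v => by
        have := mul_nonneg c.2 (hY v)
        rw [← smul_eq_mul, ← dotProduct_smul, ← Matrix.smul_mulVec, ← Matrix.smul_mul,
          ← Matrix.mul_smul] at this
        exact this }
  have hs : ∀ Y, Y ∈ s ↔ ∀ v : ι → ℝ, 0 ≤ v ⬝ᵥ ((E * Y * E).mulVec v) := fun Y => Iff.rfl
  have hsp : ∀ z ∈ Λ, Q z ∈ s → (Q z).PosSemidef := by
    intro z hz h
    rw [hs, hΛ2 z hz] at h
    exact Matrix.posSemidef_real_iff.2 ⟨hsym z, h⟩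
  let QΛ := Q.domRestrict Λ
  obtain ⟨φ, hφ⟩ : ∃ φ : Matrix ι ι ℝ →ₗ[ℝ] ℝ, φ ∘ₗ QΛ = (ev x).domRestrict Λ := by
    have hker : LinearMap.ker QΛ ≤ LinearMap.ker ((ev x).domRestrict Λ) := by
      intro z hz
      have hz' : Q z = 0 := hz
      have h1 := hev x z (by rw [hz']; exact Matrix.PosSemidef.zero)
      have h2 := hev x (-z) (by rw [map_neg, hz', neg_zero]; exact Matrix.PosSemidef.zero)
      rw [map_neg] at h2
      change ev x z = 0
      linarith
    obtain ⟨ψ, hψ⟩ := (QΛ.ker.liftQ _ hker ∘ₗ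
      QΛ.quotKerEquivRange.symm.toLinearMap).exists_extend
    refine ⟨ψ, LinearMap.ext fun z => ?_⟩
    have h1 := congrArg (fun f => f (QΛ.rangeRestrict z)) hψ
    have h2 : QΛ.quotKerEquivRange.symm (QΛ.rangeRestrict z) = Submodule.Quotient.mk z := by
      rw [LinearEquiv.symm_apply_eq]; rfl
    simp only [LinearMap.comp_apply, LinearEquiv.coe_coe, h2] at h1
    exact h1
  have hφ' : ∀ z ∈ Λ, φ (Q z) = ev x z := fun z hz => congrArg (fun f => f ⟨z, hz⟩) hφ
  obtain ⟨g, hg1, hg2⟩ := riesz_extension s ⟨LinearMap.range QΛ, φ.domRestrict _⟩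
    (by
      rintro ⟨_, z, rfl⟩ hz
      change 0 ≤ φ (Q z)
      rw [hφ' z z.2]
      exact hev x z (hsp z z.2 hz))
    (by
      intro Y
      obtain ⟨C, hC⟩ : ∃ C : ℝ, ∀ w : ι → ℝ, -C * (w ⬝ᵥ w) ≤ w ⬝ᵥ (Y.mulVec w) := by
        refine ⟨∑ i, ∑ j, |Y i j|, fun w => ?_⟩
        have h1 : ∀ i j, -(|Y i j| * (w ⬝ᵥ w)) ≤ w i * (Y i j * w j) := by
          intro i j
          have hww : ∀ i, w i * w i ≤ w ⬝ᵥ w := fun i =>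
            Finset.single_le_sum (f := fun i => w i * w i) (fun i _ => mul_self_nonneg _)
              (Finset.mem_univ i)
          have h2 : |w i * w j| ≤ w ⬝ᵥ w := by
            rw [abs_le]; constructor
            · nlinarith [hww i, hww j, sq_nonneg (w i + w j)]
            · nlinarith [hww i, hww j, sq_nonneg (w i - w j)]
          have h3 : |w i * (Y i j * w j)| ≤ |Y i j| * (w ⬝ᵥ w) := by
            rw [show w i * (Y i j * w j) = Y i j * (w i * w j) by ring, abs_mul]
            exact mul_le_mul_of_nonneg_left h2 (abs_nonneg _)
          exact (abs_le.1 h3).1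
        have h2 : w ⬝ᵥ (Y.mulVec w) = ∑ i, ∑ j, w i * (Y i j * w j) := by
          simp only [dotProduct, Matrix.mulVec, Finset.mul_sum]
        rw [h2]
        generalize w ⬝ᵥ w = q at h1
        rw [neg_mul, Finset.sum_mul, ← Finset.sum_neg_distrib]
        refine Finset.sum_le_sum fun i _ => ?_
        rw [Finset.sum_mul, ← Finset.sum_neg_distrib]
        exact Finset.sum_le_sum fun j _ => h1 i j
      let t := |C| / δ
      refine ⟨⟨Q (t • z₀), ⟨t • z₀, Λ.smul_mem t (hΛ _ hM₀p)⟩, rfl⟩, ?_⟩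
      rw [hs]
      intro v
      change 0 ≤ v ⬝ᵥ ((E * (Q (t • z₀) + Y) * E).mulVec v)
      set w := E.mulVec v with hw
      have hEw : E.mulVec w = w := by rw [hw, Matrix.mulVec_mulVec, hEE]
      have hEv : ∀ A : Matrix ι ι ℝ, v ⬝ᵥ ((E * A * E).mulVec v) = w ⬝ᵥ (A.mulVec w) := by
        intro A
        rw [← Matrix.mulVec_mulVec, ← hw, ← Matrix.mulVec_mulVec, Matrix.dotProduct_mulVec,
          ← Matrix.mulVec_transpose, hET]
      rw [hEv, map_smul, Matrix.add_mulVec, dotProduct_add, Matrix.smul_mulVec, dotProduct_smul,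
        smul_eq_mul]
      have h1 := (Matrix.posSemidef_real_iff.1 hpos).2 w
      rw [Matrix.sub_mulVec, dotProduct_sub, Matrix.smul_mulVec, hEw, dotProduct_smul,
        smul_eq_mul, sub_nonneg] at h1
      have h2 := hC w
      have hww : 0 ≤ w ⬝ᵥ w := Finset.sum_nonneg fun i _ => mul_self_nonneg _
      have h3 : t * (δ * (w ⬝ᵥ w)) ≤ t * (w ⬝ᵥ ((Q z₀).mulVec w)) :=
        mul_le_mul_of_nonneg_left h1 (by positivity)
      have h4 : t * (δ * (w ⬝ᵥ w)) = |C| * (w ⬝ᵥ w) := by simp only [t]; field_simp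
      have h5 : C * (w ⬝ᵥ w) ≤ |C| * (w ⬝ᵥ w) := mul_le_mul_of_nonneg_right (le_abs_self C) hww
      linarith)
  let Z₁ : Matrix ι ι ℝ := Matrix.of fun i j => g (Matrix.single i j 1)
  have hgZ : ∀ Y : Matrix ι ι ℝ, g Y = (Y * Z₁.transpose).trace := by
    intro Y
    conv_lhs => rw [Matrix.matrix_eq_sum_single Y]
    simp only [map_sum, Matrix.trace, Matrix.diag, Matrix.mul_apply, Matrix.transpose_apply, Z₁,
      Matrix.of_apply]
    refine Finset.sum_congr rfl fun i _ => Finset.sum_congr rfl fun j _ => ?_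
    rw [← mul_one (Y i j), ← smul_eq_mul, ← Matrix.smul_single, map_smul, smul_eq_mul, smul_eq_mul,
      mul_one]
  have hgZ2 : ∀ Y : Matrix ι ι ℝ, Y.transpose = Y → g Y = (Y * Z₁).trace := by
    intro Y hY
    rw [hgZ, ← Matrix.trace_transpose, Matrix.transpose_mul, Matrix.transpose_transpose, hY,
      Matrix.trace_mul_comm]
  refine ⟨(1 / 2 : ℝ) • (Z₁ + Z₁.transpose), ?_, fun z hz => ?_⟩
  · rw [Matrix.posSemidef_real_iff]
    constructor
    · rw [Matrix.transpose_smul, Matrix.transpose_add, Matrix.transpose_transpose, add_comm]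
    · intro v
      have hvs : Matrix.vecMulVec v v ∈ s := by
        rw [hs]
        intro u
        rw [Matrix.mul_vecMulVec, Matrix.vecMulVec_mul, Matrix.vecMulVec_mulVec]
        rw [dotProduct_smul]
        rw [← Matrix.mulVec_transpose, hET]
        simp only [MulOpposite.smul_eq_mul_unop, MulOpposite.unop_op]
        rw [dotProduct_comm u]
        exact mul_self_nonneg _
      have h1 := hg2 _ hvs
      have hvv : (Matrix.vecMulVec v v).transpose = Matrix.vecMulVec v v := by
        ext i j; simp [Matrix.vecMulVec_apply, mul_comm]
      have key : ∀ A : Matrix ι ι ℝ, (Matrix.vecMulVec v v * A).trace = v ⬝ᵥ (A.mulVec v) := by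
        intro A
        rw [Matrix.vecMulVec_mul, Matrix.trace_vecMulVec, Matrix.dotProduct_mulVec, dotProduct_comm]
      rw [Matrix.smul_mulVec, Matrix.add_mulVec, dotProduct_smul, dotProduct_add, ← key, ← key,
        ← hgZ, ← hgZ2 _ hvv, smul_eq_mul]
      linarith
  · rw [Matrix.mul_smul, Matrix.mul_add, Matrix.trace_smul, Matrix.trace_add, ← hgZ,
      ← hgZ2 _ (hsym z), smul_eq_mul]
    have h1 : g (Q z) = φ (Q z) := hg1 ⟨Q z, ⟨z, hz⟩, rfl⟩
    rw [h1, hφ' z hz]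
    ring

/-- A convex cone that is a spectrahedral shadow has bounded positive semidefinite Gram data for
any family of linear functionals that are nonnegative on it. -/
theorem IsSpectrahedralShadow.exists_gram {k : ℕ} {P : Set (Fin k → ℝ)}
    (hP : IsSpectrahedralShadow P) (h0 : 0 ∈ P) (hsmul : ∀ c ∈ P, ∀ s : ℝ, 0 ≤ s → s • c ∈ P)
    {X : Type*} (ev : X → (Fin k → ℝ) →ₗ[ℝ] ℝ) (hev : ∀ x, ∀ c ∈ P, 0 ≤ ev x c) :
    ∃ (D r : ℕ) (b : Fin r → Fin k → ℝ) (R : Fin r → Matrix (Fin D) (Fin D) ℝ)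
      (Z : X → Matrix (Fin D) (Fin D) ℝ) (xs : List X) (C : ℝ),
      (∀ x, (Z x).PosSemidef) ∧ (∀ i x, (R i * Z x).trace = ev x (b i)) ∧ 0 ≤ C ∧
      ∀ c ∈ P, ∃ a : Fin r → ℝ, c = ∑ i, a i • b i ∧ (∑ i, a i • R i).PosSemidef ∧
        (∑ i, a i • R i).trace ≤ C * (xs.map fun x => ev x c).sum := by
  obtain ⟨D, m, -, A, B, C, hA, hB, hC, hPeq⟩ := hP
  have hmem : ∀ ξ, ξ ∈ P ↔ ∃ η : Fin m → ℝ, (A + ∑ i, ξ i • B i + ∑ j, η j • C j).PosSemidef :=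
    fun ξ => by rw [hPeq]; rfl
  let Q : ((Fin k → ℝ) × ℝ × (Fin m → ℝ)) →ₗ[ℝ] Matrix (Fin D) (Fin D) ℝ :=
    LinearMap.toSpanSingleton ℝ _ A ∘ₗ LinearMap.fst ℝ _ _ ∘ₗ LinearMap.snd ℝ _ _ +
    Fintype.linearCombination ℝ B ∘ₗ LinearMap.fst ℝ _ _ +
    Fintype.linearCombination ℝ C ∘ₗ LinearMap.snd ℝ _ _ ∘ₗ LinearMap.snd ℝ _ _
  have hQ : ∀ c t η, Q (c, t, η) = t • A + ∑ i, c i • B i + ∑ j, η j • C j := fun c t η => rfl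
  have hsym : ∀ z, (Q z).transpose = Q z := by
    rintro ⟨c, t, η⟩
    rw [hQ]
    simp only [Matrix.transpose_add, Matrix.transpose_smul, Matrix.transpose_sum, hA.eq,
      fun i => (hB i).eq, fun i => (hC i).eq]
  have hlift : ∀ c ∈ P,
      ∃ z, z.1 = c ∧ (Q z).PosSemidef := by
    intro c hc
    obtain ⟨η, h⟩ := (hmem c).1 hc
    exact ⟨(c, 1, η), rfl, by rw [hQ, one_smul]; exact h⟩
  have hproj : ∀ z, (Q z).PosSemidef →
      z.1 ∈ P := by
    rintro ⟨c, t, η⟩ h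
    obtain ⟨η₀, h₀⟩ := (hmem 0).1 h0
    have hpos : 0 < 1 + |t| := by positivity
    set s := (1 + |t|)⁻¹ with hs
    have hs0 : 0 < s := inv_pos.2 hpos
    have hst : s * t ≤ 1 := by
      rw [hs, inv_mul_le_iff₀ hpos]; nlinarith [le_abs_self t]
    have h1 : s • c ∈ P := by
      refine (hmem _).2 ⟨s • η + (1 - s * t) • η₀, ?_⟩
      have h2 := (h.smul hs0.le).add (h₀.smul (sub_nonneg.2 hst))
      convert h2 using 1
      have hA1 : A = (s * t) • A + (1 - s * t) • A := by rw [← add_smul, add_sub_cancel, one_smul]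
      rw [hQ]
      generalize 1 - s * t = u at *
      simp only [Pi.add_apply, Pi.smul_apply, Pi.zero_apply, add_smul, Finset.sum_add_distrib,
        smul_add, Finset.smul_sum, smul_smul, smul_eq_mul, zero_smul,
        Finset.sum_const_zero, smul_zero]
      nth_rewrite 1 [hA1]
      abel
    have h2 := hsmul _ h1 (1 + |t|) hpos.le
    rwa [smul_smul, hs, mul_inv_cancel₀ hpos.ne', one_smul] at h2
  let ev' : X → ((Fin k → ℝ) × ℝ × (Fin m → ℝ)) →ₗ[ℝ] ℝ := fun x => ev x ∘ₗ LinearMap.fst ℝ _ _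
  obtain ⟨Λ, hΛ, hZ⟩ := exists_posSemidef_dual Q hsym ev' (fun x z hz => hev x _ (hproj z hz))
  choose Z hZp hZ using hZ
  obtain ⟨M₀, hM₀, E, δ, hδ, hET, hEE, hpos, hE⟩ := exists_maximal_range_posSemidef
    {M | M.PosSemidef ∧ ∃ xs : List X, ∀ z ∈ Λ, (Q z * M).trace = (xs.map fun x => ev x z.1).sum}
    ⟨Matrix.PosSemidef.zero, [], by simp⟩
    (by
      rintro M ⟨hM, xs, hxs⟩ N ⟨hN, ys, hys⟩
      refine ⟨hM.add hN, xs ++ ys, fun z hz => ?_⟩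
      rw [Matrix.mul_add, Matrix.trace_add, hxs z hz, hys z hz, List.map_append, List.sum_append])
    (fun M hM => hM.1)
  have hZE : ∀ x, Z x * E = Z x := fun x => hE _ ⟨hZp x, [x], fun z hz => by
    rw [hZ x z hz]; simp [ev']⟩
  have hEZ : ∀ x, E * Z x = Z x := fun x => by
    have h1 := congrArg Matrix.transpose (hZE x)
    rwa [Matrix.transpose_mul, hET, (Matrix.posSemidef_real_iff.1 (hZp x)).1] at h1
  obtain ⟨-, xs, hxs⟩ := hM₀
  let bs := Module.finBasis ℝ Λ
  refine ⟨D, _, fun i => (bs i).1.1, fun i => E * Q (bs i) * E, Z, xs, δ⁻¹, hZp,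
    ?_, by positivity, ?_⟩
  · intro i x
    rw [Matrix.mul_assoc, Matrix.mul_assoc, hEZ, Matrix.trace_mul_comm, Matrix.mul_assoc, hZE,
      hZ x _ (bs i).2]
    rfl
  · intro c hc
    obtain ⟨z, rfl, hz⟩ := hlift c hc
    have hzΛ := hΛ z hz
    have hrepr : z = ∑ i, bs.repr ⟨z, hzΛ⟩ i • (bs i : ((Fin k → ℝ) × ℝ × (Fin m → ℝ))) := by
      have := congrArg Λ.subtype (bs.sum_repr ⟨z, hzΛ⟩)
      rw [map_sum] at this
      exact this.symm
    have hR : ∑ i, bs.repr ⟨z, hzΛ⟩ i • (E * Q (bs i) * E) = E * Q z * E := by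
      conv_rhs => rw [hrepr]
      simp only [map_sum, map_smul, Matrix.mul_sum, Matrix.sum_mul, Matrix.mul_smul,
        Matrix.smul_mul]
    refine ⟨bs.repr ⟨z, hzΛ⟩, ?_, ?_, ?_⟩
    · have h1 := congrArg (LinearMap.fst ℝ (Fin k → ℝ) (ℝ × (Fin m → ℝ))) hrepr
      rw [map_sum] at h1
      exact h1
    · rw [hR]
      have := hz.mul_mul_conjTranspose_same E
      rwa [Matrix.conjTranspose_eq_transpose_of_trivial, hET] at this
    · rw [hR, Matrix.trace_mul_comm, ← Matrix.mul_assoc, hEE, Matrix.trace_mul_comm]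
      have h1 := Matrix.PosSemidef.trace_mul_nonneg hz hpos
      rw [Matrix.mul_sub, Matrix.mul_smul, Matrix.trace_sub, Matrix.trace_smul, hxs z hzΛ,
        smul_eq_mul, sub_nonneg] at h1
      rw [inv_mul_eq_div, le_div_iff₀ hδ, mul_comm]
      exact h1

open MvPolynomial in
theorem exists_taylor_gram {m D r N : ℕ} (R : Fin r → Matrix (Fin D) (Fin D) ℝ)
    (p : Fin r → MvPolynomial (Fin m) ℝ) (Z : (Fin m → ℝ) → Matrix (Fin D) (Fin D) ℝ)
    (hZ : ∀ x, (Z x).PosSemidef) (hRZ : ∀ i x, (R i * Z x).trace = eval x (p i)) :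
    ∃ (x : Fin m → ℝ) (K : ℝ), 0 ≤ K ∧ ∀ a : Fin r → ℝ, (∑ i, a i • R i).PosSemidef →
      ∃ f : Fin D × Fin D → MvPolynomial (Fin m) ℝ,
        (∀ s β, coeff β (f s) ^ 2 ≤ K * (∑ i, a i • R i).trace) ∧
        ∑ s, f s ^ 2 - ∑ i, a i • aeval (fun j => C (x j) + X j) (p i) ∈
          idealOfVars (Fin m) ℝ ^ N := by
  obtain ⟨x, τ, hτS, hτx⟩ := exists_taylor_ringHom
    (S := Set.range (fun t : Fin r × Fin D × Fin D => R t.1 t.2.1 t.2.2) ∪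
      Set.range (fun t : Fin r × (Fin m →₀ ℕ) => coeff t.2 (p t.1)))
    ((Set.countable_range _).union (Set.countable_range _)) m N
  have hτR : ∀ i a b, τ (R i a b) = Ideal.Quotient.mk _ (C (R i a b)) := fun i a b =>
    hτS _ (Or.inl ⟨(i, a, b), rfl⟩)
  have hτp : ∀ i, τ (eval x (p i)) =
      Ideal.Quotient.mk _ (aeval (fun j => C (x j) + X j) (p i)) := by
    intro i
    rw [eval_eq', aeval_def, eval₂_eq']
    simp only [map_sum, map_mul, map_prod, map_pow, hτx]
    refine Finset.sum_congr rfl fun β _ => ?_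
    rw [hτS _ (Or.inr ⟨(i, β), rfl⟩)]
    rfl
  obtain ⟨B, hB⟩ := (hZ x).exists_eq_transpose_mul_self
  choose W hW using fun l a => Ideal.Quotient.mk_surjective (τ (B l a))
  have hmain : ∀ i, Ideal.Quotient.mk (idealOfVars (Fin m) ℝ ^ N)
      (∑ l, ∑ a, ∑ b, C (R i a b) * (W l a * W l b)) =
      Ideal.Quotient.mk _ (aeval (fun j => C (x j) + X j) (p i)) := by
    intro i
    rw [← hτp, ← hRZ, hB]
    simp only [Matrix.trace, Matrix.diag, Matrix.mul_apply, Matrix.transpose_apply, Finset.mul_sum,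
      map_sum, map_mul, hτR, hW]
    rw [Finset.sum_comm]
    refine Finset.sum_congr rfl fun a _ => ?_
    rw [Finset.sum_comm]
    refine Finset.sum_congr rfl fun b _ => Finset.sum_congr rfl fun l _ => ?_
    ring
  refine ⟨x, ∑ l, ∑ a, ∑ β ∈ (W l a).support, coeff β (W l a) ^ 2,
    Finset.sum_nonneg fun _ _ => Finset.sum_nonneg fun _ _ => Finset.sum_nonneg fun _ _ =>
      sq_nonneg _, fun a ha => ?_⟩
  obtain ⟨U, hU⟩ := ha.exists_eq_transpose_mul_self
  have hUR : ∀ c d, ∑ i, a i * R i c d = ∑ k, U k c * U k d := by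
    intro c d
    have := congrFun (congrFun hU c) d
    simpa [Matrix.sum_apply, Matrix.mul_apply] using this
  refine ⟨fun s => ∑ c, C (U s.1 c) * W s.2 c, fun s β => ?_, ?_⟩
  · rw [coeff_sum]
    simp only [coeff_C_mul]
    have h1 := Finset.sum_mul_sq_le_sq_mul_sq Finset.univ (fun c => U s.1 c)
      (fun c => coeff β (W s.2 c))
    refine h1.trans ?_
    rw [mul_comm]
    refine mul_le_mul ?_ ?_ (Finset.sum_nonneg fun _ _ => sq_nonneg _) ?_
    · refine le_trans ?_ (Finset.single_le_sum (f := fun l => ∑ a, ∑ β ∈ (W l a).support,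
        coeff β (W l a) ^ 2) (fun _ _ => Finset.sum_nonneg fun _ _ => Finset.sum_nonneg fun _ _ =>
        sq_nonneg _) (Finset.mem_univ s.2))
      refine Finset.sum_le_sum fun c _ => ?_
      by_cases hβ : β ∈ (W s.2 c).support
      · exact Finset.single_le_sum (f := fun β => coeff β (W s.2 c) ^ 2) (fun _ _ => sq_nonneg _) hβ
      · rw [notMem_support_iff.1 hβ, zero_pow two_ne_zero]
        exact Finset.sum_nonneg fun _ _ => sq_nonneg _
    · rw [hU]
      simp only [Matrix.trace, Matrix.diag, Matrix.mul_apply, Matrix.transpose_apply, ← sq]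
      rw [Finset.sum_comm]
      exact Finset.single_le_sum (f := fun k => ∑ c, U k c ^ 2)
        (fun _ _ => Finset.sum_nonneg fun _ _ => sq_nonneg _) (Finset.mem_univ s.1)
    · exact Finset.sum_nonneg fun _ _ => Finset.sum_nonneg fun _ _ => Finset.sum_nonneg fun _ _ =>
        sq_nonneg _
  · rw [← Ideal.Quotient.eq_zero_iff_mem, map_sub, sub_eq_zero]
    have h1 : ∑ s : Fin D × Fin D, (∑ c, C (U s.1 c) * W s.2 c) ^ 2 =
        ∑ i, C (a i) * ∑ l, ∑ c, ∑ d, C (R i c d) * (W l c * W l d) := by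
      have h2 : ∑ i, C (a i) * ∑ l, ∑ c, ∑ d, C (R i c d) * (W l c * W l d) =
          ∑ l, ∑ c, ∑ d, C (∑ i, a i * R i c d) * (W l c * W l d) := by
        simp only [Finset.mul_sum, map_sum, map_mul, Finset.sum_mul]
        rw [Finset.sum_comm]
        refine Finset.sum_congr rfl fun l _ => ?_
        rw [Finset.sum_comm]
        refine Finset.sum_congr rfl fun c _ => ?_
        rw [Finset.sum_comm]
        refine Finset.sum_congr rfl fun d _ => Finset.sum_congr rfl fun i _ => ?_
        ring
      rw [h2, Fintype.sum_prod_type, Finset.sum_comm]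
      refine Finset.sum_congr rfl fun l _ => ?_
      simp only [hUR, map_sum, map_mul, Finset.sum_mul, sq, Finset.mul_sum]
      rw [Finset.sum_comm]
      refine Finset.sum_congr rfl fun c _ => ?_
      rw [Finset.sum_comm]
      refine Finset.sum_congr rfl fun d _ => Finset.sum_congr rfl fun k _ => ?_
      ring
    rw [h1]
    simp only [map_sum, smul_eq_C_mul, map_mul]
    refine Finset.sum_congr rfl fun i _ => ?_
    rw [← hmain i]
    simp only [map_sum, map_mul]

theorem sum_mul_mul_ge_of_coercive {ι : Type*} [DecidableEq ι] (S H : Finset ι)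
    (hSH : Disjoint S H) (b : ι → ι → ℝ) (hb : ∀ i j, b i j = b j i) {A κ : ℝ} (hκ : 0 < κ)
    (hA : ∀ i j, |b i j| ≤ A) (hHH : ∀ i ∈ H, ∀ j ∈ H, b i j = 0)
    (hS : ∀ g : ι → ℝ, κ * ∑ i ∈ S, g i ^ 2 ≤ ∑ i ∈ S, ∑ j ∈ S, g i * g j * b i j) :
    ∃ C : ℝ, 0 ≤ C ∧ ∀ g : ι → ℝ,
      -(C * ∑ i ∈ H, g i ^ 2) ≤ ∑ i ∈ S ∪ H, ∑ j ∈ S ∪ H, g i * g j * b i j := by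
  set h : ℝ := H.card + 1 with hh
  have hh0 : 0 < h := by positivity
  refine ⟨S.card * (A ^ 2 * h / κ), by positivity, fun g => ?_⟩
  have h1 : ∑ i ∈ S ∪ H, ∑ j ∈ S ∪ H, g i * g j * b i j =
      ∑ i ∈ S, ∑ j ∈ S, g i * g j * b i j + ∑ i ∈ S, ∑ j ∈ H, 2 * (g i * g j * b i j) := by
    simp only [Finset.sum_union hSH, Finset.sum_add_distrib]
    have h2 : ∑ i ∈ H, ∑ j ∈ H, g i * g j * b i j = 0 :=
      Finset.sum_eq_zero fun i hi => Finset.sum_eq_zero fun j hj => by rw [hHH i hi j hj, mul_zero]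
    have h3 : ∑ i ∈ H, ∑ j ∈ S, g i * g j * b i j = ∑ i ∈ S, ∑ j ∈ H, g i * g j * b i j := by
      rw [Finset.sum_comm]
      exact Finset.sum_congr rfl fun i _ => Finset.sum_congr rfl fun j _ => by rw [hb j i]; ring
    rw [h2, h3]
    simp only [← Finset.mul_sum]
    ring
  have h4 : ∀ i j, -(κ / h * g i ^ 2 + A ^ 2 * h / κ * g j ^ 2) ≤ 2 * (g i * g j * b i j) := by
    intro i j
    have h5 : κ / h * g i ^ 2 + A ^ 2 * h / κ * g j ^ 2 + 2 * (g i * g j * b i j) =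
        κ / h * (g i + h / κ * b i j * g j) ^ 2 + h / κ * (A ^ 2 - b i j ^ 2) * g j ^ 2 := by
      field_simp
      ring
    have h6 : 0 ≤ A ^ 2 - b i j ^ 2 := by
      have := pow_le_pow_left₀ (abs_nonneg _) (hA i j) 2
      rw [sq_abs] at this
      linarith
    have h7 : 0 ≤ κ / h * (g i + h / κ * b i j * g j) ^ 2 +
        h / κ * (A ^ 2 - b i j ^ 2) * g j ^ 2 := by positivity
    linarith
  have h8 : ∑ i ∈ S, ∑ j ∈ H, -(κ / h * g i ^ 2 + A ^ 2 * h / κ * g j ^ 2) ≤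
      ∑ i ∈ S, ∑ j ∈ H, 2 * (g i * g j * b i j) :=
    Finset.sum_le_sum fun i _ => Finset.sum_le_sum fun j _ => h4 i j
  have h9 : ∑ i ∈ S, ∑ j ∈ H, -(κ / h * g i ^ 2 + A ^ 2 * h / κ * g j ^ 2) =
      -((H.card * (κ / h)) * ∑ i ∈ S, g i ^ 2) -
        S.card * (A ^ 2 * h / κ) * ∑ j ∈ H, g j ^ 2 := by
    simp only [Finset.sum_neg_distrib, Finset.sum_add_distrib, Finset.sum_const, nsmul_eq_mul,
      ← Finset.mul_sum]
    ring
  have h10 : (H.card * (κ / h)) * ∑ i ∈ S, g i ^ 2 ≤ κ * ∑ i ∈ S, g i ^ 2 := by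
    refine mul_le_mul_of_nonneg_right ?_ (Finset.sum_nonneg fun _ _ => sq_nonneg _)
    rw [mul_div_assoc', div_le_iff₀ hh0, hh]
    nlinarith
  have h11 := hS g
  linarith

open MvPolynomial in
/-- The linear functional sending the monomial `x ^ β` to `ε ^ |β| * l β`. -/
noncomputable def scaledFunctional {m : ℕ} (l : (Fin m →₀ ℕ) → ℝ) (ε : ℝ) :
    MvPolynomial (Fin m) ℝ →ₗ[ℝ] ℝ :=
  (basisMonomials (Fin m) ℝ).constr ℝ fun β => ε ^ β.degree * l β

open MvPolynomial in
theorem scaledFunctional_monomial {m : ℕ} (l : (Fin m →₀ ℕ) → ℝ) (ε : ℝ) (β : Fin m →₀ ℕ) (c : ℝ) :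
    scaledFunctional l ε (monomial β c) = c * (ε ^ β.degree * l β) := by
  have h := (basisMonomials (Fin m) ℝ).constr_basis ℝ (fun β => ε ^ β.degree * l β) β
  rw [coe_basisMonomials] at h
  have h2 : monomial β c = c • monomial β (1 : ℝ) := by rw [smul_monomial, smul_eq_mul, mul_one]
  rw [h2, map_smul, smul_eq_mul]
  exact congrArg _ h

open MvPolynomial in
theorem scaledFunctional_ge_of_sum_sq {m e : ℕ} (l : (Fin m →₀ ℕ) → ℝ)
    (hl : ∀ β, 2 * e < β.degree → l β = 0) (S : Finset (Fin m →₀ ℕ))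
    (hS : ∀ α, α ∈ S ↔ α.degree ≤ e) {κ : ℝ} (hκ : 0 < κ)
    (hpos : ∀ g : (Fin m →₀ ℕ) → ℝ,
      κ * ∑ i ∈ S, g i ^ 2 ≤ ∑ i ∈ S, ∑ j ∈ S, g i * g j * l (i + j)) :
    ∃ C : ℝ, 0 ≤ C ∧ ∀ ε : ℝ, 0 ≤ ε → ε ≤ 1 → ∀ {σ : Type} [Fintype σ] (K : ℝ)
      (f : σ → MvPolynomial (Fin m) ℝ) (p : MvPolynomial (Fin m) ℝ),
      (∀ s β, coeff β (f s) ^ 2 ≤ K) → ∑ s, f s ^ 2 - p ∈ idealOfVars (Fin m) ℝ ^ (2 * e + 1) →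
      -(Fintype.card σ * (C * (ε ^ (2 * e + 2) * K))) ≤ scaledFunctional l ε p := by
  classical
  let T : Finset (Fin m →₀ ℕ) := (Finsupp.finite_of_degree_le (σ := Fin m) (2 * e)).toFinset
  have hT : ∀ α, α ∈ T ↔ α.degree ≤ 2 * e := fun α => by simp [T]
  have hST : S ⊆ T := fun α hα => (hT α).2 (by have := (hS α).1 hα; omega)
  obtain ⟨C, hC, hquad⟩ := sum_mul_mul_ge_of_coercive S (T \ S) Finset.disjoint_sdiff
    (fun i j => l (i + j)) (fun i j => by rw [add_comm]) hκ (A := ∑ β ∈ T, |l β|)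
    (fun i j => by
      by_cases h : i + j ∈ T
      · exact Finset.single_le_sum (f := fun β => |l β|) (fun _ _ => abs_nonneg _) h
      · rw [hl _ (by rw [hT] at h; omega), abs_zero]
        exact Finset.sum_nonneg fun _ _ => abs_nonneg _)
    (fun i hi j hj => by
      apply hl
      rw [Finset.mem_sdiff, hS] at hi hj
      rw [map_add]
      omega)
    hpos
  rw [Finset.union_sdiff_of_subset hST] at hquad
  refine ⟨C * (T \ S).card, by positivity, fun ε hε hε1 σ _ K f p hK hp => ?_⟩
  have hzero : ∀ q ∈ idealOfVars (Fin m) ℝ ^ (2 * e + 1), scaledFunctional l ε q = 0 := by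
    intro q hq
    rw [mem_pow_idealOfVars_iff'] at hq
    rw [q.as_sum, map_sum]
    refine Finset.sum_eq_zero fun β _ => ?_
    rw [scaledFunctional_monomial]
    by_cases h : β.degree < 2 * e + 1
    · rw [hq β h, zero_mul]
    · rw [hl β (by omega), mul_zero, mul_zero]
  have hp2 := hzero _ hp
  rw [map_sub, sub_eq_zero, map_sum] at hp2
  rw [← hp2, ← nsmul_eq_mul, ← smul_neg]
  rw [← Finset.card_univ, ← Finset.sum_const]
  refine Finset.sum_le_sum fun s _ => ?_
  let q : MvPolynomial (Fin m) ℝ := ∑ α ∈ T, monomial α (coeff α (f s))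
  have hq : scaledFunctional l ε (f s ^ 2) = scaledFunctional l ε (q ^ 2) := by
    rw [← sub_eq_zero, ← map_sub]
    apply hzero
    rw [sq_sub_sq]
    refine Ideal.mul_mem_left _ _ ?_
    rw [mem_pow_idealOfVars_iff']
    intro α hα
    rw [coeff_sub, coeff_sum]
    simp only [coeff_monomial]
    rw [Finset.sum_ite_eq' T α, if_pos ((hT α).2 (by omega)), sub_self]
  have hq2 : scaledFunctional l ε (q ^ 2) = ∑ i ∈ T, ∑ j ∈ T,
      (ε ^ i.degree * coeff i (f s)) * (ε ^ j.degree * coeff j (f s)) * l (i + j) := by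
    rw [sq, Finset.sum_mul_sum, map_sum]
    refine Finset.sum_congr rfl fun i _ => ?_
    rw [map_sum]
    refine Finset.sum_congr rfl fun j _ => ?_
    rw [monomial_mul, scaledFunctional_monomial, map_add, pow_add]
    ring
  rw [hq, hq2]
  refine le_trans ?_ (hquad fun i => ε ^ i.degree * coeff i (f s))
  rw [mul_assoc]
  refine neg_le_neg (mul_le_mul_of_nonneg_left ?_ hC)
  rw [← nsmul_eq_mul, ← Finset.sum_const]
  refine Finset.sum_le_sum fun i hi => ?_
  rw [Finset.mem_sdiff, hS] at hi
  rw [mul_pow, ← pow_mul]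
  exact mul_le_mul (pow_le_pow_of_le_one hε hε1 (by omega)) (hK s i) (sq_nonneg _) (by positivity)

open MvPolynomial in
theorem aeval_eq_sum_mono_of_isHomogeneous {n d N : ℕ} {mono : Fin N → (Fin n →₀ ℕ)}
    (hinj : Function.Injective mono)
    (hrange : Set.range mono = {α : Fin n →₀ ℕ | ∑ i, α i = d})
    {F : MvPolynomial (Fin n) ℝ} (hF : F.IsHomogeneous d) {A : Type*} [CommRing A] [Algebra ℝ A]
    (y : Fin n → A) :
    aeval y F = ∑ j, coeff (mono j) F • ∏ i, y i ^ mono j i := by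
  classical
  rw [aeval_def, eval₂_eq']
  have h1 : ∑ j, coeff (mono j) F • ∏ i, y i ^ mono j i =
      ∑ β ∈ Finset.univ.image mono, coeff β F • ∏ i, y i ^ β i := by
    rw [Finset.sum_image (fun a _ b _ h => hinj h)]
  rw [h1]
  simp only [Algebra.smul_def]
  apply Finset.sum_subset
  · intro β hβ
    have h2 := hF (mem_support_iff.1 hβ)
    have h3 : β ∈ Set.range mono := by
      rw [hrange, Set.mem_ofPred_eq, ← h2]
      simp [Finsupp.weight_apply, Finsupp.sum_fintype]
    obtain ⟨j, rfl⟩ := h3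
    exact Finset.mem_image_of_mem _ (Finset.mem_univ _)
  · intro β _ hβ
    rw [notMem_support_iff.1 hβ, map_zero, zero_mul]

open MvPolynomial in
theorem not_isSpectrahedralShadow_of_functional {n d m e N : ℕ}
    {mono : Fin N → (Fin n →₀ ℕ)} (hinj : Function.Injective mono)
    (hrange : Set.range mono = {α : Fin n →₀ ℕ | ∑ i, α i = 2 * d})
    {P : Set (Fin N → ℝ)}
    (hP : P = {c : Fin N → ℝ | ∀ ξ : Fin n → ℝ, 0 ≤ ∑ j, c j * ∏ i, ξ i ^ mono j i})
    (hed : e ≤ d) (o : Fin n) (ι : Fin m → Fin n) (hι : Function.Injective ι) (ho : ∀ i, ι i ≠ o)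
    (M : MvPolynomial (Fin m) ℝ) (hMdeg : ∀ β ∈ M.support, β.degree ≤ 2 * e)
    (hM : ∀ x, 0 ≤ eval x M) (l : (Fin m →₀ ℕ) → ℝ)
    (hl : ∀ β, 2 * e < β.degree → l β = 0) (S : Finset (Fin m →₀ ℕ))
    (hS : ∀ α, α ∈ S ↔ α.degree ≤ e) {κ : ℝ} (hκ : 0 < κ)
    (hpos : ∀ g : (Fin m →₀ ℕ) → ℝ,
      κ * ∑ i ∈ S, g i ^ 2 ≤ ∑ i ∈ S, ∑ j ∈ S, g i * g j * l (i + j))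
    (hneg : scaledFunctional l 1 M < 0) : ¬ IsSpectrahedralShadow P := by
  intro hshadow
  have hmem : ∀ c, c ∈ P ↔ ∀ ξ : Fin n → ℝ, 0 ≤ ∑ j, c j * ∏ i, ξ i ^ mono j i :=
    fun c => by rw [hP]; rfl
  let ζ : Fin n → MvPolynomial (Fin m) ℝ := Function.extend ι X fun j => if j = o then 1 else 0
  have hζι : ∀ i, ζ (ι i) = X i := fun i => hι.extend_apply _ _ i
  have hζo : ζ o = 1 := by
    have : ¬ ∃ i, ι i = o := fun ⟨i, hi⟩ => ho i hi
    simp only [ζ]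
    rw [Function.extend_apply' _ _ _ this, if_pos rfl]
  let pol : (Fin N → ℝ) →ₗ[ℝ] MvPolynomial (Fin m) ℝ :=
    Fintype.linearCombination ℝ fun j => ∏ i, ζ i ^ mono j i
  have hpol : ∀ c, pol c = ∑ j, c j • ∏ i, ζ i ^ mono j i := fun c => rfl
  let ev : (Fin m → ℝ) → (Fin N → ℝ) →ₗ[ℝ] ℝ := fun x => (aeval x).toLinearMap ∘ₗ pol
  have hev : ∀ x c, ev x c = ∑ j, c j * ∏ i, (eval x (ζ i)) ^ mono j i := by
    intro x c
    change aeval x (pol c) = _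
    rw [hpol, map_sum]
    refine Finset.sum_congr rfl fun j _ => ?_
    rw [map_smul, smul_eq_mul, map_prod]
    simp only [map_pow]
    rfl
  obtain ⟨D, r, b, R, Z, xs, C₀, hZ, hRZ, hC₀, hgram⟩ := hshadow.exists_gram
    ((hmem 0).2 fun ξ => by simp)
    (fun c hc s hs => (hmem _).2 fun ξ => by
      have := mul_nonneg hs ((hmem c).1 hc ξ)
      rw [Finset.mul_sum] at this
      simpa only [Pi.smul_apply, smul_eq_mul, mul_assoc] using this)
    ev (fun x c hc => by rw [hev]; exact (hmem c).1 hc _)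
  obtain ⟨x, K, hK, hx⟩ := exists_taylor_gram (N := 2 * e + 1) R (fun i => pol (b i)) Z hZ
    (fun i x => hRZ i x)
  let F : ℝ → MvPolynomial (Fin n) ℝ := fun ε => ∑ β ∈ M.support,
    C (coeff β M * ε ^ (2 * e - β.degree)) * (X o ^ (2 * d - β.degree) *
      ∏ i, (X (ι i) - C (x i) * X o) ^ β i)
  have hFhom : ∀ ε, (F ε).IsHomogeneous (2 * d) := by
    intro ε
    refine IsHomogeneous.sum _ _ _ fun β hβ => ?_
    have h1 : (X o ^ (2 * d - β.degree) * ∏ i, (X (ι i) - C (x i) * X o) ^ β i :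
        MvPolynomial (Fin n) ℝ).IsHomogeneous ((2 * d - β.degree) + ∑ i, β i) := by
      refine (isHomogeneous_X_pow _ _).mul (IsHomogeneous.prod _ _ _ fun i _ => ?_)
      have h2 : (X (ι i) - C (x i) * X o : MvPolynomial (Fin n) ℝ).IsHomogeneous 1 :=
        (isHomogeneous_X _ _).sub (by
          simpa using (isHomogeneous_C _ (x i)).mul (isHomogeneous_X ℝ o))
      simpa using h2.pow (β i)
    have h3 : (2 * d - β.degree) + ∑ i, β i = 2 * d := by
      have := hMdeg β hβ
      rw [Finsupp.degree_eq_sum] at *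
      omega
    rw [h3] at h1
    simpa using (isHomogeneous_C _ (coeff β M * ε ^ (2 * e - β.degree))).mul h1
  let Mε : ℝ → MvPolynomial (Fin m) ℝ := fun ε => ∑ β ∈ M.support,
    monomial β (coeff β M * ε ^ (2 * e - β.degree))
  have hFM : ∀ (ε : ℝ) (y : Fin n → ℝ), y o ≠ 0 → 0 < ε →
      eval y (F ε) = y o ^ (2 * d) * (ε ^ (2 * e) *
        eval (fun i => (y (ι i) / y o - x i) / ε) M) := by
    intro ε y hy hε
    rw [eval_eq' (fun i => (y (ι i) / y o - x i) / ε), Finset.mul_sum, Finset.mul_sum, map_sum]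
    refine Finset.sum_congr rfl fun β hβ => ?_
    simp only [map_mul, map_pow, map_sub, map_prod, eval_C, eval_X]
    have h1 : ∏ i, (y (ι i) - x i * y o) ^ β i =
        y o ^ β.degree * (ε ^ β.degree * ∏ i, ((y (ι i) / y o - x i) / ε) ^ β i) := by
      rw [Finsupp.degree_eq_sum, ← Finset.prod_pow_eq_pow_sum, ← Finset.prod_pow_eq_pow_sum,
        ← Finset.prod_mul_distrib, ← Finset.prod_mul_distrib]
      refine Finset.prod_congr rfl fun i _ => ?_
      rw [← mul_pow, ← mul_pow]
      congr 1
      field_simp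
    rw [h1]
    have h2 := hMdeg β hβ
    rw [show y o ^ (2 * d) = y o ^ (2 * d - β.degree) * y o ^ β.degree by
        rw [← pow_add]; congr 1; omega,
      show ε ^ (2 * e) = ε ^ (2 * e - β.degree) * ε ^ β.degree by
        rw [← pow_add]; congr 1; omega]
    ring
  have hFnonneg : ∀ ε, 0 < ε → ∀ y : Fin n → ℝ, 0 ≤ eval y (F ε) := by
    intro ε hε y
    have h1 : ∀ y : Fin n → ℝ, y o ≠ 0 → 0 ≤ eval y (F ε) := by
      intro y hy
      rw [hFM ε y hy hε]
      exact mul_nonneg (by rw [pow_mul]; positivity) (mul_nonneg (by positivity) (hM _))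
    by_cases hy : y o = 0
    · have hcont : Continuous fun t : ℝ => eval (Function.update y o t) (F ε) :=
        (MvPolynomial.continuous_eval _).comp (continuous_const.update o continuous_id)
      have h2 : Filter.Tendsto (fun t : ℝ => eval (Function.update y o t) (F ε))
          (nhdsWithin 0 {0}ᶜ) (nhds (eval y (F ε))) := by
        have h3 := hcont.tendsto 0
        rw [← hy, Function.update_eq_self, hy] at h3
        exact h3.mono_left nhdsWithin_le_nhds
      refine ge_of_tendsto h2 ?_
      filter_upwards [self_mem_nhdsWithin] with t ht
      exact h1 _ (by rw [Function.update_self]; exact ht)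
    · exact h1 y hy
  let c : ℝ → Fin N → ℝ := fun ε j => coeff (mono j) (F ε)
  have hcP : ∀ ε, 0 < ε → c ε ∈ P := by
    intro ε hε
    rw [hmem]
    intro ξ
    have h1 := aeval_eq_sum_mono_of_isHomogeneous hinj hrange (hFhom ε) ξ
    have h2 := hFnonneg ε hε ξ
    rw [← coe_aeval_eq_eval, RingHom.coe_coe, h1] at h2
    exact h2
  have hpolc : ∀ ε, pol (c ε) = aeval ζ (F ε) := fun ε => by
    rw [hpol, aeval_eq_sum_mono_of_isHomogeneous hinj hrange (hFhom ε) ζ]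
  have htaylor : ∀ ε, aeval (fun j => C (x j) + X j) (pol (c ε)) = Mε ε := by
    intro ε
    rw [hpolc]
    simp only [F, map_sum, map_mul, map_pow, map_sub, map_prod, aeval_X, hζι, hζo, aeval_C,
      one_pow, one_mul, mul_one, Mε, algebraMap_eq]
    refine Finset.sum_congr rfl fun β _ => ?_
    rw [monomial_eq, Finsupp.prod_fintype _ _ (fun i => pow_zero _)]
    congr 1
    · simp
    · refine Finset.prod_congr rfl fun i _ => ?_
      rw [add_sub_cancel_left]
  have hLM : ∀ ε, scaledFunctional l ε (Mε ε) = ε ^ (2 * e) * scaledFunctional l 1 M := by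
    intro ε
    conv_rhs => rw [M.as_sum]
    simp only [Mε, map_sum, scaledFunctional_monomial, Finset.mul_sum]
    refine Finset.sum_congr rfl fun β hβ => ?_
    rw [show ε ^ (2 * e) = ε ^ (2 * e - β.degree) * ε ^ β.degree by
        rw [← pow_add]; congr 1; have := hMdeg β hβ; omega]
    ring
  have hcont : Continuous fun ε => (xs.map fun x => ev x (c ε)).sum := by
    refine continuous_list_sum (l := xs) (f := fun x ε => ev x (c ε)) fun y _ => ?_
    have h1 : (fun ε => ev y (c ε)) = fun ε => eval (fun i => eval y (ζ i)) (F ε) := by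
      funext ε
      rw [hev]
      exact (aeval_eq_sum_mono_of_isHomogeneous hinj hrange (hFhom ε) _).symm
    rw [h1]
    simp only [F, map_sum, map_mul, eval_C]
    fun_prop
  obtain ⟨V, hV⟩ := (isCompact_Icc (a := (0 : ℝ)) (b := 1)).bddAbove_image hcont.continuousOn
  obtain ⟨C₁, hC₁, hbound⟩ := scaledFunctional_ge_of_sum_sq l hl S hS hκ hpos
  set G : ℝ := Fintype.card (Fin D × Fin D) * (C₁ * (K * (C₀ * V))) with hG
  have hfinal : ∀ ε, 0 < ε → ε ≤ 1 → -(ε ^ 2 * G) ≤ scaledFunctional l 1 M := by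
    intro ε hε hε1
    obtain ⟨a, hca, ha, htr⟩ := hgram (c ε) (hcP ε hε)
    obtain ⟨f, hf, hfm⟩ := hx a ha
    have h1 : ∑ i, a i • aeval (fun j => C (x j) + X j) (pol (b i)) = Mε ε := by
      rw [← htaylor, hca]
      simp only [map_sum, map_smul]
    rw [h1] at hfm
    have hKV : K * (∑ i, a i • R i).trace ≤ K * (C₀ * V) :=
      mul_le_mul_of_nonneg_left (htr.trans (mul_le_mul_of_nonneg_left
        (hV (Set.mem_image_of_mem _ ⟨hε.le, hε1⟩)) hC₀)) hK
    have h2 := hbound ε hε.le hε1 (K * (C₀ * V)) f (Mε ε) (fun s β => (hf s β).trans hKV) hfm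
    rw [hLM] at h2
    have h3 : 0 < ε ^ (2 * e) := by positivity
    rw [pow_add] at h2
    refine le_of_mul_le_mul_left ?_ h3
    calc _ = _ := by rw [hG]; ring
      _ ≤ _ := h2
  have hlim : Filter.Tendsto (fun ε : ℝ => -(ε ^ 2 * G)) (nhdsWithin 0 (Set.Ioi 0)) (nhds 0) := by
    have : Continuous fun ε : ℝ => -(ε ^ 2 * G) := by fun_prop
    have h2 := this.tendsto 0
    simp only [ne_eq, OfNat.ofNat_ne_zero, not_false_eq_true, zero_pow, zero_mul, neg_zero] at h2
    exact h2.mono_left nhdsWithin_le_nhds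
  have hge : 0 ≤ scaledFunctional l 1 M := by
    refine le_of_tendsto hlim ?_
    filter_upwards [Ioc_mem_nhdsGT (zero_lt_one (α := ℝ))] with ε hε
    exact hfinal ε hε.1 hε.2
  linarith

/-- A truncated moment functional in two variables that is positive definite on cubics but negative
on the Motzkin polynomial. -/
noncomputable def motzkinMoment : ℕ → ℕ → ℝ
  | 0, 0 => 1 / 2
  | 2, 0 => 4
  | 0, 2 => 4
  | 4, 0 => 100
  | 0, 4 => 100
  | 2, 2 => 1
  | 6, 0 => 10000
  | 0, 6 => 10000
  | 4, 2 => 1 / 2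
  | 2, 4 => 1 / 2
  | _, _ => 0

/-- A truncated moment functional in three variables that is positive definite on quadratics but
negative on the Choi-Lam polynomial. -/
noncomputable def choiLamMoment : ℕ → ℕ → ℕ → ℝ
  | 0, 0, 0 => 1
  | 2, 0, 0 => 5
  | 0, 2, 0 => 5
  | 0, 0, 2 => 5
  | 4, 0, 0 => 100
  | 0, 4, 0 => 100
  | 0, 0, 4 => 100
  | 2, 2, 0 => 1
  | 2, 0, 2 => 1
  | 0, 2, 2 => 1
  | 1, 1, 1 => 2
  | _, _, _ => 0

theorem motzkinMoment_coercive (h : Fin 10 → ℝ) :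
    (1 / 100) * ∑ i, h i ^ 2 ≤ ∑ i, ∑ j, h i * h j *
      motzkinMoment ((![0, 2, 0, 1, 3, 1, 0, 0, 2, 1] : Fin 10 → ℕ) i +
          (![0, 2, 0, 1, 3, 1, 0, 0, 2, 1] : Fin 10 → ℕ) j)
        ((![0, 0, 2, 0, 0, 2, 1, 3, 1, 1] : Fin 10 → ℕ) i +
          (![0, 0, 2, 0, 0, 2, 1, 3, 1, 1] : Fin 10 → ℕ) j) := by
  simp only [Fin.sum_univ_succ, Fin.sum_univ_zero, Matrix.cons_val_zero, Matrix.cons_val_succ,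
    Nat.reduceAdd, motzkinMoment]
  generalize h 0 = a0,
    h (Fin.succ 0) = a1,
    h (Fin.succ (Fin.succ 0)) = a2,
    h (Fin.succ (Fin.succ (Fin.succ 0))) = a3,
    h (Fin.succ (Fin.succ (Fin.succ (Fin.succ 0)))) = a4,
    h (Fin.succ (Fin.succ (Fin.succ (Fin.succ (Fin.succ 0))))) = a5,
    h (Fin.succ (Fin.succ (Fin.succ (Fin.succ (Fin.succ (Fin.succ 0)))))) = a6,
    h (Fin.succ (Fin.succ (Fin.succ (Fin.succ (Fin.succ (Fin.succ (Fin.succ 0))))))) = a7,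
    h (Fin.succ (Fin.succ (Fin.succ (Fin.succ (Fin.succ (Fin.succ (Fin.succ (Fin.succ 0)))))))) = a8,
    h (Fin.succ (Fin.succ (Fin.succ (Fin.succ (Fin.succ (Fin.succ (Fin.succ (Fin.succ
      (Fin.succ 0))))))))) = a9
  have h1 : 0 ≤ 49 / 100 * a0 ^ 2 + 8 * a0 * (a1 + a2) + 9999 / 100 * (a1 ^ 2 + a2 ^ 2) +
      2 * a1 * a2 := by
    nlinarith [sq_nonneg (a0 + 400 / 49 * (a1 + a2)), sq_nonneg (a1 + a2), sq_nonneg (a1 - a2)]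
  have h2 : ∀ x y z : ℝ, 0 ≤ 399 / 100 * x ^ 2 + 999999 / 100 * y ^ 2 + 49 / 100 * z ^ 2 +
      200 * x * y + 2 * x * z + y * z := fun x y z => by
    nlinarith [sq_nonneg (x + 200 / 3 * y), sq_nonneg (x + 20 / 49 * z),
      sq_nonneg (z + 25 / 4 * y), sq_nonneg x, sq_nonneg y, sq_nonneg z]
  have h3 := h2 a3 a4 a5
  have h4 := h2 a6 a7 a8
  have h5 := sq_nonneg a9
  linarith

theorem choiLamMoment_coercive (h : Fin 10 → ℝ) :
    (1 / 100) * ∑ i, h i ^ 2 ≤ ∑ i, ∑ j, h i * h j *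
      choiLamMoment ((![0, 2, 0, 0, 1, 0, 0, 1, 0, 1] : Fin 10 → ℕ) i +
          (![0, 2, 0, 0, 1, 0, 0, 1, 0, 1] : Fin 10 → ℕ) j)
        ((![0, 0, 2, 0, 0, 1, 1, 0, 0, 1] : Fin 10 → ℕ) i +
          (![0, 0, 2, 0, 0, 1, 1, 0, 0, 1] : Fin 10 → ℕ) j)
        ((![0, 0, 0, 2, 0, 1, 0, 1, 1, 0] : Fin 10 → ℕ) i +
          (![0, 0, 0, 2, 0, 1, 0, 1, 1, 0] : Fin 10 → ℕ) j) := by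
  simp only [Fin.sum_univ_succ, Fin.sum_univ_zero, Matrix.cons_val_zero, Matrix.cons_val_succ,
    Nat.reduceAdd, choiLamMoment]
  generalize h 0 = a0,
    h (Fin.succ 0) = a1,
    h (Fin.succ (Fin.succ 0)) = a2,
    h (Fin.succ (Fin.succ (Fin.succ 0))) = a3,
    h (Fin.succ (Fin.succ (Fin.succ (Fin.succ 0)))) = a4,
    h (Fin.succ (Fin.succ (Fin.succ (Fin.succ (Fin.succ 0))))) = a5,
    h (Fin.succ (Fin.succ (Fin.succ (Fin.succ (Fin.succ (Fin.succ 0)))))) = a6,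
    h (Fin.succ (Fin.succ (Fin.succ (Fin.succ (Fin.succ (Fin.succ (Fin.succ 0))))))) = a7,
    h (Fin.succ (Fin.succ (Fin.succ (Fin.succ (Fin.succ (Fin.succ (Fin.succ (Fin.succ 0)))))))) = a8,
    h (Fin.succ (Fin.succ (Fin.succ (Fin.succ (Fin.succ (Fin.succ (Fin.succ (Fin.succ
      (Fin.succ 0))))))))) = a9
  have h1 : 0 ≤ 99 / 100 * a0 ^ 2 + 10 * a0 * (a1 + a2 + a3) +
      9999 / 100 * (a1 ^ 2 + a2 ^ 2 + a3 ^ 2) + 2 * (a1 * a2 + a1 * a3 + a2 * a3) := by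
    nlinarith [sq_nonneg (a0 + 500 / 99 * (a1 + a2 + a3)), sq_nonneg (a1 - a2), sq_nonneg (a1 - a3),
      sq_nonneg (a2 - a3), sq_nonneg a1, sq_nonneg a2, sq_nonneg a3]
  have h2 : ∀ x y : ℝ, 0 ≤ 499 / 100 * x ^ 2 + 99 / 100 * y ^ 2 + 4 * x * y := fun x y => by
    nlinarith [sq_nonneg (y + 200 / 99 * x), sq_nonneg x, sq_nonneg y]
  have h3 := h2 a4 a5
  have h4 := h2 a6 a7
  have h5 := h2 a8 a9
  linarith

open MvPolynomial in
theorem not_isSpectrahedralShadow_of_three_le {n d N : ℕ} (hn : 3 ≤ n) (hd : 3 ≤ d)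
    {mono : Fin N → (Fin n →₀ ℕ)} (hinj : Function.Injective mono)
    (hrange : Set.range mono = {α : Fin n →₀ ℕ | ∑ i, α i = 2 * d})
    {P : Set (Fin N → ℝ)}
    (hP : P = {c : Fin N → ℝ | ∀ ξ : Fin n → ℝ, 0 ≤ ∑ j, c j * ∏ i, ξ i ^ mono j i}) :
    ¬ IsSpectrahedralShadow P := by
  let v : ℕ → ℕ → (Fin 2 →₀ ℕ) := fun a b => Finsupp.equivFunOnFinite.symm ![a, b]
  have hv0 : ∀ a b, v a b 0 = a := fun a b => rfl
  have hv1 : ∀ a b, v a b 1 = b := fun a b => rfl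
  have hdeg : ∀ β : Fin 2 →₀ ℕ, β.degree = β 0 + β 1 := fun β => by
    rw [Finsupp.degree_eq_sum, Fin.sum_univ_two]
  have hvv : ∀ β : Fin 2 →₀ ℕ, β = v (β 0) (β 1) := fun β => by
    ext i; fin_cases i <;> rfl
  let M : MvPolynomial (Fin 2) ℝ := monomial (v 4 2) 1 + monomial (v 2 4) 1 + monomial (v 0 0) 1 +
    monomial (v 2 2) (-3)
  let l : (Fin 2 →₀ ℕ) → ℝ := fun β => motzkinMoment (β 0) (β 1)
  let u : Fin 10 → (Fin 2 →₀ ℕ) := fun k => v ((![0, 2, 0, 1, 3, 1, 0, 0, 2, 1] : Fin 10 → ℕ) k)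
    ((![0, 0, 2, 0, 0, 2, 1, 3, 1, 1] : Fin 10 → ℕ) k)
  have hu : Function.Injective u := by
    intro i j hij
    have h0 : u i 0 = u j 0 := by rw [hij]
    have h1 : u i 1 = u j 1 := by rw [hij]
    clear hij
    revert h0 h1
    simp only [u, hv0, hv1]
    revert i j
    decide
  refine not_isSpectrahedralShadow_of_functional hinj hrange hP hd (⟨0, by omega⟩ : Fin n)
    (fun i : Fin 2 => ⟨i + 1, by omega⟩) (fun i j h => by simpa [Fin.ext_iff] using h)
    (fun i h => by simp at h) M ?_ ?_ l ?_ (Finset.univ.image u) ?_ (κ := 1 / 100)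
    (by norm_num) ?_ ?_
  · intro β hβ
    rw [mem_support_iff] at hβ
    by_contra hd
    rw [hdeg] at hd
    have h1 : ∀ a b, a + b ≤ 6 → v a b ≠ β := by
      rintro a b hab rfl
      rw [hv0, hv1] at hd
      omega
    apply hβ
    simp only [M, coeff_add, coeff_monomial, if_neg (h1 4 2 (by norm_num)),
      if_neg (h1 2 4 (by norm_num)), if_neg (h1 0 0 (by norm_num)), if_neg (h1 2 2 (by norm_num)),
      add_zero]
  · intro x
    simp only [M, map_add, eval_monomial, Finsupp.prod_fintype _ _ (fun i => pow_zero _),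
      Fin.prod_univ_two, hv0, hv1]
    set a := x 0
    set b := x 1
    have h1 : |a * b| ^ 2 = a ^ 2 * b ^ 2 := by rw [sq_abs, mul_pow]
    have h2 : 2 * |a * b| ≤ a ^ 2 + b ^ 2 := by
      have := abs_le.2 ⟨(by nlinarith [sq_nonneg (a + b)] : -((a ^ 2 + b ^ 2) / 2) ≤ a * b),
        by nlinarith [sq_nonneg (a - b)]⟩
      linarith
    have h3 := abs_nonneg (a * b)
    have h4 : 0 ≤ (|a * b| - 1) ^ 2 * (2 * |a * b| + 1) := by positivity
    have h5 : 0 ≤ |a * b| ^ 2 * (a ^ 2 + b ^ 2 - 2 * |a * b|) :=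
      mul_nonneg (sq_nonneg _) (by linarith)
    have h6 : 1 * (a ^ 4 * b ^ 2) + 1 * (a ^ 2 * b ^ 4) + 1 * (a ^ 0 * b ^ 0) +
        -3 * (a ^ 2 * b ^ 2) = |a * b| ^ 2 * (a ^ 2 + b ^ 2) + 1 - 3 * |a * b| ^ 2 := by
      rw [h1]; ring
    rw [h6]
    nlinarith
  · intro β hβ
    rw [hdeg] at hβ
    simp only [l]
    unfold motzkinMoment
    split <;> first | rfl | omega
  · intro α
    rw [hdeg, Finset.mem_image]
    constructor
    · rintro ⟨k, -, rfl⟩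
      simp only [u, hv0, hv1]
      revert k
      decide
    · intro h
      obtain ⟨a, ha⟩ : ∃ a, a = α 0 := ⟨_, rfl⟩
      obtain ⟨b, hb⟩ : ∃ b, b = α 1 := ⟨_, rfl⟩
      rw [← ha, ← hb] at h
      have h1 : ∀ a ≤ 3, ∀ b ≤ 3, a + b ≤ 3 → ∃ k : Fin 10,
          (![0, 2, 0, 1, 3, 1, 0, 0, 2, 1] : Fin 10 → ℕ) k = a ∧
          (![0, 0, 2, 0, 0, 2, 1, 3, 1, 1] : Fin 10 → ℕ) k = b := by decide
      obtain ⟨k, hk1, hk2⟩ := h1 a (by omega) b (by omega) h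
      refine ⟨k, Finset.mem_univ _, ?_⟩
      rw [hvv α, ← ha, ← hb, ← hk1, ← hk2]
  · intro g
    rw [Finset.sum_image fun a _ b _ h => hu h, Finset.sum_image fun a _ b _ h => hu h]
    simp only [Finset.sum_image fun a _ b _ h => hu h]
    exact motzkinMoment_coercive fun k => g (u k)
  · simp only [M, map_add, scaledFunctional_monomial, l, hv0, hv1, motzkinMoment, one_pow]
    norm_num

open MvPolynomial in
theorem not_isSpectrahedralShadow_of_four_le {n d N : ℕ} (hn : 4 ≤ n) (hd : 2 ≤ d)
    {mono : Fin N → (Fin n →₀ ℕ)} (hinj : Function.Injective mono)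
    (hrange : Set.range mono = {α : Fin n →₀ ℕ | ∑ i, α i = 2 * d})
    {P : Set (Fin N → ℝ)}
    (hP : P = {c : Fin N → ℝ | ∀ ξ : Fin n → ℝ, 0 ≤ ∑ j, c j * ∏ i, ξ i ^ mono j i}) :
    ¬ IsSpectrahedralShadow P := by
  let v : ℕ → ℕ → ℕ → (Fin 3 →₀ ℕ) := fun a b c => Finsupp.equivFunOnFinite.symm ![a, b, c]
  have hv0 : ∀ a b c, v a b c 0 = a := fun a b c => rfl
  have hv1 : ∀ a b c, v a b c 1 = b := fun a b c => rfl
  have hv2 : ∀ a b c, v a b c 2 = c := fun a b c => rfl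
  have hdeg : ∀ β : Fin 3 →₀ ℕ, β.degree = β 0 + β 1 + β 2 := fun β => by
    rw [Finsupp.degree_eq_sum, Fin.sum_univ_three]
  have hvv : ∀ β : Fin 3 →₀ ℕ, β = v (β 0) (β 1) (β 2) := fun β => by
    ext i; fin_cases i <;> rfl
  let M : MvPolynomial (Fin 3) ℝ := monomial (v 0 0 0) 1 + monomial (v 2 2 0) 1 +
    monomial (v 0 2 2) 1 + monomial (v 2 0 2) 1 + monomial (v 1 1 1) (-4)
  let l : (Fin 3 →₀ ℕ) → ℝ := fun β => choiLamMoment (β 0) (β 1) (β 2)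
  let u : Fin 10 → (Fin 3 →₀ ℕ) := fun k => v ((![0, 2, 0, 0, 1, 0, 0, 1, 0, 1] : Fin 10 → ℕ) k)
    ((![0, 0, 2, 0, 0, 1, 1, 0, 0, 1] : Fin 10 → ℕ) k)
    ((![0, 0, 0, 2, 0, 1, 0, 1, 1, 0] : Fin 10 → ℕ) k)
  have hu : Function.Injective u := by
    intro i j hij
    have h0 : u i 0 = u j 0 := by rw [hij]
    have h1 : u i 1 = u j 1 := by rw [hij]
    have h2 : u i 2 = u j 2 := by rw [hij]
    clear hij
    revert h0 h1 h2
    simp only [u, hv0, hv1, hv2]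
    revert i j
    decide
  refine not_isSpectrahedralShadow_of_functional hinj hrange hP hd (⟨0, by omega⟩ : Fin n)
    (fun i : Fin 3 => ⟨i + 1, by omega⟩) (fun i j h => by simpa [Fin.ext_iff] using h)
    (fun i h => by simp at h) M ?_ ?_ l ?_ (Finset.univ.image u) ?_ (κ := 1 / 100)
    (by norm_num) ?_ ?_
  · intro β hβ
    rw [mem_support_iff] at hβ
    by_contra hd
    rw [hdeg] at hd
    have h1 : ∀ a b c, a + b + c ≤ 4 → v a b c ≠ β := by
      rintro a b c hab rfl
      rw [hv0, hv1, hv2] at hd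
      omega
    apply hβ
    simp only [M, coeff_add, coeff_monomial, if_neg (h1 0 0 0 (by norm_num)),
      if_neg (h1 2 2 0 (by norm_num)), if_neg (h1 0 2 2 (by norm_num)),
      if_neg (h1 2 0 2 (by norm_num)), if_neg (h1 1 1 1 (by norm_num)), add_zero]
  · intro x
    simp only [M, map_add, eval_monomial, Finsupp.prod_fintype _ _ (fun i => pow_zero _),
      Fin.prod_univ_three, hv0, hv1, hv2]
    set a := x 0
    set b := x 1
    set c := x 2
    rcases le_total 0 (a * b) with hab | hab
    · nlinarith [sq_nonneg (1 - a * b), sq_nonneg (c * (a - b)), mul_nonneg hab (sq_nonneg (1 - c))]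
    · nlinarith [sq_nonneg (1 + a * b), sq_nonneg (c * (a + b)),
        mul_nonneg (neg_nonneg.2 hab) (sq_nonneg (1 + c))]
  · intro β hβ
    rw [hdeg] at hβ
    simp only [l]
    unfold choiLamMoment
    split <;> first | rfl | omega
  · intro α
    rw [hdeg, Finset.mem_image]
    constructor
    · rintro ⟨k, -, rfl⟩
      simp only [u, hv0, hv1, hv2]
      revert k
      decide
    · intro h
      obtain ⟨a, ha⟩ : ∃ a, a = α 0 := ⟨_, rfl⟩
      obtain ⟨b, hb⟩ : ∃ b, b = α 1 := ⟨_, rfl⟩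
      obtain ⟨c, hc⟩ : ∃ c, c = α 2 := ⟨_, rfl⟩
      rw [← ha, ← hb, ← hc] at h
      have h1 : ∀ a b c : Fin 3, (a : ℕ) + b + c ≤ 2 → ∃ k : Fin 10,
          (![0, 2, 0, 0, 1, 0, 0, 1, 0, 1] : Fin 10 → ℕ) k = a ∧
          (![0, 0, 2, 0, 0, 1, 1, 0, 0, 1] : Fin 10 → ℕ) k = b ∧
          (![0, 0, 0, 2, 0, 1, 0, 1, 1, 0] : Fin 10 → ℕ) k = c := by decide
      obtain ⟨k, hk1, hk2, hk3⟩ := h1 ⟨a, by omega⟩ ⟨b, by omega⟩ ⟨c, by omega⟩ h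
      refine ⟨k, Finset.mem_univ _, ?_⟩
      rw [hvv α, ← ha, ← hb, ← hc]
      simp only [u, hk1, hk2, hk3]
  · intro g
    rw [Finset.sum_image fun a _ b _ h => hu h, Finset.sum_image fun a _ b _ h => hu h]
    simp only [Finset.sum_image fun a _ b _ h => hu h]
    exact choiLamMoment_coercive fun k => g (u k)
  · simp only [M, map_add, scaledFunctional_monomial, l, hv0, hv1, hv2, choiLamMoment, one_pow]
    norm_num

/-- A real function given by a homogeneous polynomial of degree `d` in `n` variables. -/
def IsForm (n d : ℕ) (f : (Fin n → ℝ) → ℝ) : Prop :=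
  ∃ p : MvPolynomial (Fin n) ℝ, p.IsHomogeneous d ∧ ∀ v, MvPolynomial.eval v p = f v

namespace IsForm

variable {n m d e : ℕ} {f g : (Fin n → ℝ) → ℝ}

theorem add (hf : IsForm n d f) (hg : IsForm n d g) : IsForm n d fun v => f v + g v := by
  obtain ⟨p, hp, hpf⟩ := hf
  obtain ⟨q, hq, hqg⟩ := hg
  exact ⟨p + q, hp.add hq, fun v => by simp [hpf, hqg]⟩

theorem mul (hf : IsForm n d f) (hg : IsForm n e g) : IsForm n (d + e) fun v => f v * g v := by
  obtain ⟨p, hp, hpf⟩ := hf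
  obtain ⟨q, hq, hqg⟩ := hg
  exact ⟨p * q, hp.mul hq, fun v => by simp [hpf, hqg]⟩

theorem pow (hf : IsForm n d f) (k : ℕ) : IsForm n (d * k) fun v => f v ^ k := by
  obtain ⟨p, hp, hpf⟩ := hf
  exact ⟨p ^ k, hp.pow k, fun v => by simp [hpf]⟩

theorem const_mul (hf : IsForm n d f) (c : ℝ) : IsForm n d fun v => c * f v := by
  obtain ⟨p, hp, hpf⟩ := hf
  exact ⟨MvPolynomial.C c * p, hp.C_mul c, fun v => by simp [hpf]⟩

theorem sub (hf : IsForm n d f) (hg : IsForm n d g) : IsForm n d fun v => f v - g v := by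
  obtain ⟨p, hp, hpf⟩ := hf
  obtain ⟨q, hq, hqg⟩ := hg
  exact ⟨p - q, hp.sub hq, fun v => by simp [hpf, hqg]⟩

theorem coord (i : Fin n) : IsForm n 1 fun v => v i :=
  ⟨MvPolynomial.X i, MvPolynomial.isHomogeneous_X _ _, fun v => by simp⟩

theorem const (c : ℝ) : IsForm n 0 fun _ => c :=
  ⟨MvPolynomial.C c, MvPolynomial.isHomogeneous_C _ _, fun v => by simp⟩

theorem zero : IsForm n d fun _ => 0 :=
  ⟨0, MvPolynomial.isHomogeneous_zero _ _ _, fun v => by simp⟩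

theorem sum {ι : Type*} (s : Finset ι) {f : ι → (Fin n → ℝ) → ℝ} (hf : ∀ i ∈ s, IsForm n d (f i)) :
    IsForm n d fun v => ∑ i ∈ s, f i v := by
  classical
  induction s using Finset.induction_on with
  | empty => simpa using zero
  | insert a s ha ih =>
    simp only [Finset.sum_insert ha]
    exact (hf a (by simp)).add (ih fun i hi => hf i (by simp [hi]))

theorem congr (hf : IsForm n d f) (h : ∀ v, g v = f v) : IsForm n d g := by
  obtain ⟨p, hp, hpf⟩ := hf
  exact ⟨p, hp, fun v => by rw [hpf, h]⟩

theorem comp {f : (Fin m → ℝ) → ℝ} (hf : IsForm m d f) {t : (Fin n → ℝ) → Fin m → ℝ}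
    (ht : ∀ i, IsForm n 1 fun v => t v i) : IsForm n d fun v => f (t v) := by
  obtain ⟨p, hp, hpf⟩ := hf
  choose q hq hqt using ht
  refine ⟨MvPolynomial.aeval q p, by simpa using hp.aeval q hq, fun v => ?_⟩
  change _ = f (t v)
  rw [← hpf, ← MvPolynomial.coe_aeval_eq_eval, RingHom.coe_coe, MvPolynomial.comp_aeval_apply,
    MvPolynomial.aeval_def, ← MvPolynomial.coe_aeval_eq_eval]
  simp only [RingHom.coe_coe, MvPolynomial.aeval_def]
  congr 1
  ext i
  exact hqt i v

theorem comp_linear {f : (Fin m → ℝ) → ℝ} (hf : IsForm m d f) (T : (Fin n → ℝ) →ₗ[ℝ] Fin m → ℝ) :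
    IsForm n d fun v => f (T v) := by
  refine hf.comp fun i => ?_
  refine (sum Finset.univ (f := fun j v => T (Pi.single j 1) i * v j) fun j _ =>
    (coord j).const_mul _).congr fun v => ?_
  conv_lhs => rw [← Finset.univ_sum_single v, map_sum, Finset.sum_apply]
  refine Finset.sum_congr rfl fun j _ => ?_
  have : (Pi.single j (v j) : Fin n → ℝ) = v j • Pi.single j 1 := by
    rw [← Pi.single_smul, smul_eq_mul, mul_one]
  rw [this, map_smul, Pi.smul_apply, smul_eq_mul, mul_comm]

theorem continuous (hf : IsForm n d f) : Continuous f := by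
  obtain ⟨p, hp, hpf⟩ := hf
  rw [← funext hpf]
  exact MvPolynomial.continuous_eval p

theorem map_smul (hf : IsForm n d f) (c : ℝ) (v : Fin n → ℝ) : f (c • v) = c ^ d * f v := by
  obtain ⟨p, hp, hpf⟩ := hf
  rw [← hpf, ← hpf, MvPolynomial.eval_eq, MvPolynomial.eval_eq, Finset.mul_sum]
  refine Finset.sum_congr rfl fun s hs => ?_
  have h1 : s.degree = d := by
    by_contra h
    exact (MvPolynomial.mem_support_iff.1 hs) (hp.coeff_eq_zero h)
  simp only [Pi.smul_apply, smul_eq_mul, mul_pow, Finset.prod_mul_distrib]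
  rw [Finset.prod_pow_eq_pow_sum, show ∑ i ∈ s.support, s i = d from h1]
  ring

theorem map_zero (hf : IsForm n d f) (hd : d ≠ 0) : f 0 = 0 := by
  have := hf.map_smul 0 0
  rwa [zero_smul, zero_pow hd, zero_mul] at this

theorem le_mul_of_pos (hf : IsForm n d f) (hg : IsForm n d g) (hd : d ≠ 0)
    (hpos : ∀ v, v ≠ 0 → 0 < f v) : ∃ C : ℝ, 0 < C ∧ ∀ v, g v ≤ C * f v := by
  have hne : ∀ v ∈ Metric.sphere (0 : Fin n → ℝ) 1, v ≠ 0 := by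
    rintro v hv rfl
    simp at hv
  obtain ⟨C, hC⟩ := (isCompact_sphere (0 : Fin n → ℝ) 1).exists_bound_of_continuousOn
    (f := fun v => g v / f v)
    (hg.continuous.continuousOn.div hf.continuous.continuousOn fun v hv => (hpos v (hne v hv)).ne')
  refine ⟨|C| + 1, by positivity, fun v => ?_⟩
  rcases eq_or_ne v 0 with rfl | hv
  · rw [hf.map_zero hd, hg.map_zero hd, mul_zero]
  have hv0 : 0 < ‖v‖ := norm_pos_iff.2 hv
  set u := ‖v‖⁻¹ • v
  have hu : u ∈ Metric.sphere (0 : Fin n → ℝ) 1 := by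
    simp [u, norm_smul, hv0.ne']
  have hvu : v = ‖v‖ • u := by simp [u, smul_smul, hv0.ne']
  have h1 : g u ≤ (|C| + 1) * f u := by
    have h2 := (le_abs_self _).trans ((hC u hu).trans ((le_abs_self C).trans (lt_add_one _).le))
    rwa [div_le_iff₀ (hpos u (hne u hu))] at h2
  rw [hvu, hg.map_smul, hf.map_smul]
  nlinarith [pow_pos hv0 d]

/-- Expanding a form in its first variable. -/
theorem exists_expansion {f : (Fin (n + 1) → ℝ) → ℝ} (hf : IsForm (n + 1) d f) :
    ∃ c : ℕ → (Fin n → ℝ) → ℝ, (∀ i j, i + j = d → IsForm n j (c i)) ∧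
      ∀ x v, f (Fin.cons x v) = ∑ i ∈ Finset.range (d + 1), x ^ i * c i v := by
  obtain ⟨p, hp, hpf⟩ := hf
  refine ⟨fun i v => MvPolynomial.eval v ((MvPolynomial.finSuccEquiv ℝ n p).coeff i),
    fun i j hij => ⟨_, hp.finSuccEquiv_coeff_isHomogeneous i j hij, fun v => rfl⟩, fun x v => ?_⟩
  rw [← hpf, MvPolynomial.eval_eq_eval_mv_eval', Polynomial.eval_eq_sum_range' (n := d + 1)]
  · simp [mul_comm]
  · refine (Polynomial.natDegree_map_le.trans ?_).trans_lt (Nat.lt_succ_self d)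
    rw [MvPolynomial.natDegree_finSuccEquiv]
    exact (MvPolynomial.degreeOf_le_totalDegree p 0).trans hp.totalDegree_le

end IsForm

/-- The form `f` of degree `2d` dominates the square of a nonzero form of degree `d`. -/
def HasSquareMinorant (n d : ℕ) (f : (Fin n → ℝ) → ℝ) : Prop :=
  ∃ q, IsForm n d q ∧ (∃ v, q v ≠ 0) ∧ ∀ v, q v ^ 2 ≤ f v

theorem HasSquareMinorant.of_comp {n d : ℕ} {f : (Fin n → ℝ) → ℝ}
    (T : (Fin n → ℝ) ≃ₗ[ℝ] Fin n → ℝ) (h : HasSquareMinorant n d fun v => f (T v)) :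
    HasSquareMinorant n d f := by
  obtain ⟨q, hq, ⟨v, hv⟩, hqf⟩ := h
  refine ⟨fun v => q (T.symm v), hq.comp_linear T.symm.toLinearMap, ⟨T v, by simpa using hv⟩,
    fun v => ?_⟩
  simpa using hqf (T.symm v)

theorem HasSquareMinorant.of_le_mul {n d : ℕ} {f q : (Fin n → ℝ) → ℝ} {C : ℝ} (hC : 0 < C)
    (hq : IsForm n d q) (hq0 : ∃ v, q v ≠ 0) (h : ∀ v, q v ^ 2 ≤ C * f v) :
    HasSquareMinorant n d f := by
  have hC' : 0 < √C := Real.sqrt_pos.2 hC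
  refine ⟨fun v => (√C)⁻¹ * q v, hq.const_mul _, ?_, fun v => ?_⟩
  · obtain ⟨v, hv⟩ := hq0
    exact ⟨v, mul_ne_zero (inv_ne_zero hC'.ne') hv⟩
  · rw [mul_pow, inv_pow, Real.sq_sqrt hC.le, inv_mul_le_iff₀ hC]
    exact h v

theorem hasSquareMinorant_of_pos {n d : ℕ} (hn : 0 < n) (hd : 0 < d) {f : (Fin n → ℝ) → ℝ}
    (hf : IsForm n (2 * d) f) (hpos : ∀ v, v ≠ 0 → 0 < f v) : HasSquareMinorant n d f := by
  have hq : IsForm n d fun v => v ⟨0, hn⟩ ^ d := by simpa using (IsForm.coord ⟨0, hn⟩).pow d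
  obtain ⟨C, hC, h⟩ := hf.le_mul_of_pos (g := fun v => (v ⟨0, hn⟩ ^ d) ^ 2)
    (by simpa [mul_comm] using hq.pow 2) (by omega) hpos
  exact .of_le_mul hC hq ⟨1, by simp⟩ h

theorem nonneg_of_ne_zero {φ : ℝ → ℝ} (hφ : Continuous φ) (h : ∀ t, t ≠ 0 → 0 ≤ φ t) (t : ℝ) :
    0 ≤ φ t := by
  rcases eq_or_ne t 0 with rfl | ht
  · exact ge_of_tendsto (hφ.continuousWithinAt (s := {0}ᶜ) (x := 0))
      (Filter.eventually_of_mem self_mem_nhdsWithin fun t ht => h t ht)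
  · exact h t ht

theorem eq_zero_of_mul_nonneg {φ : ℝ → ℝ} (hφ : Continuous φ) (h : ∀ t, 0 ≤ t * φ t) :
    φ 0 = 0 := by
  have h1 : ∀ s : ℝ, 0 ≤ φ (s ^ 2) := nonneg_of_ne_zero (by fun_prop) fun t ht => by
    have := h (t ^ 2)
    exact nonneg_of_mul_nonneg_right this (by positivity)
  have h2 : ∀ s : ℝ, 0 ≤ -φ (-s ^ 2) := nonneg_of_ne_zero (by fun_prop) fun t ht => by
    have := h (-t ^ 2)
    refine nonneg_of_mul_nonneg_right (a := t ^ 2) (by linarith) (by positivity)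
  have h3 := h1 0
  have h4 := h2 0
  simp only [ne_eq, OfNat.ofNat_ne_zero, not_false_eq_true, zero_pow, neg_zero] at h3 h4
  linarith

theorem IsForm.exists_mul_ne_zero {n d e : ℕ} {f g : (Fin n → ℝ) → ℝ} (hf : IsForm n d f)
    (hg : IsForm n e g) (hf0 : ∃ v, f v ≠ 0) (hg0 : ∃ v, g v ≠ 0) : ∃ v, f v * g v ≠ 0 := by
  obtain ⟨p, -, hpf⟩ := hf
  obtain ⟨q, -, hqg⟩ := hg
  obtain ⟨v, hv⟩ := hf0
  obtain ⟨w, hw⟩ := hg0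
  by_contra! h
  have h1 : p * q = 0 := MvPolynomial.funext fun v => by simp [hpf, hqg, h]
  rcases mul_eq_zero.1 h1 with rfl | rfl
  · exact hv (by simp [← hpf])
  · exact hw (by simp [← hqg])

theorem IsForm.tail {n d : ℕ} {f : (Fin n → ℝ) → ℝ} (hf : IsForm n d f) :
    IsForm (n + 1) d fun v => f (Fin.tail v) :=
  hf.comp fun i => IsForm.coord i.succ

/-- The linear form vanishing at `w`. -/
def perpForm (w v : Fin 2 → ℝ) : ℝ := w 0 * v 1 - w 1 * v 0

theorem isForm_perpForm (w : Fin 2 → ℝ) : IsForm 2 1 (perpForm w) :=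
  ((IsForm.coord 1).const_mul _).sub ((IsForm.coord 0).const_mul _)

theorem normSq_pos_of_ne_zero {w : Fin 2 → ℝ} (hw : w ≠ 0) : 0 < w 0 ^ 2 + w 1 ^ 2 := by
  by_contra h
  apply hw
  ext i
  fin_cases i
  · simpa using pow_eq_zero_iff (n := 2) (by norm_num) |>.1
      (by nlinarith [sq_nonneg (w 0), sq_nonneg (w 1)] : w 0 ^ 2 = 0)
  · simpa using pow_eq_zero_iff (n := 2) (by norm_num) |>.1
      (by nlinarith [sq_nonneg (w 0), sq_nonneg (w 1)] : w 1 ^ 2 = 0)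

theorem perpForm_add_smul (w v : Fin 2 → ℝ) (t : ℝ) :
    perpForm w (v + t • ![-w 1, w 0]) = perpForm w v + t * (w 0 ^ 2 + w 1 ^ 2) := by
  simp [perpForm]
  ring

theorem exists_perpForm_ne_zero {w : Fin 2 → ℝ} (hw : w ≠ 0) : ∃ v, perpForm w v ≠ 0 :=
  ⟨0 + (1 : ℝ) • ![-w 1, w 0], by
    rw [perpForm_add_smul]
    simpa [perpForm] using (normSq_pos_of_ne_zero hw).ne'⟩

theorem nonneg_of_perpForm_ne_zero {φ : (Fin 2 → ℝ) → ℝ} (hφ : Continuous φ) {w : Fin 2 → ℝ}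
    (hw : w ≠ 0) (h : ∀ v, perpForm w v ≠ 0 → 0 ≤ φ v) (v : Fin 2 → ℝ) : 0 ≤ φ v := by
  by_cases hv : perpForm w v = 0
  · have := nonneg_of_ne_zero (φ := fun t => φ (v + t • ![-w 1, w 0])) (by fun_prop)
      (fun t ht => h _ (by
        rw [perpForm_add_smul, hv, zero_add]
        exact mul_ne_zero ht (normSq_pos_of_ne_zero hw).ne')) 0
    simpa using this
  · exact h v hv

theorem IsForm.exists_eq_perpForm_mul {d : ℕ} {f : (Fin 2 → ℝ) → ℝ} (hf : IsForm 2 (d + 1) f)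
    {w : Fin 2 → ℝ} (hw : w ≠ 0) (h : f w = 0) :
    ∃ g, IsForm 2 d g ∧ ∀ v, f v = perpForm w v * g v := by
  have hr := normSq_pos_of_ne_zero hw
  set r := w 0 ^ 2 + w 1 ^ 2 with hrdef
  have h0 := IsForm.coord (n := 2) 0
  have h1 := IsForm.coord (n := 2) 1
  obtain ⟨c, hc, hfc⟩ := (hf.comp (n := 2)
    (t := fun v => ![w 0 * v 0 - w 1 * v 1, w 1 * v 0 + w 0 * v 1]) (by
      intro i
      fin_cases i
      · exact (h0.const_mul _).sub (h1.const_mul _)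
      · exact (h0.const_mul _).add (h1.const_mul _))).exists_expansion
  have hcons : ∀ (x : ℝ) (v : Fin 1 → ℝ), (Fin.cons x v : Fin 2 → ℝ) 1 = v 0 := fun _ _ => rfl
  simp only [hcons, Fin.cons_zero] at hfc
  have hlast : ∀ v, c (d + 1) v = 0 := by
    have h2 : c (d + 1) 0 = 0 := by
      have h3 := hfc 1 0
      rw [Finset.sum_range_succ, Finset.sum_eq_zero] at h3
      · have : (![w 0 * 1 - w 1 * (0 : Fin 1 → ℝ) 0, w 1 * 1 + w 0 * (0 : Fin 1 → ℝ) 0]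
            : Fin 2 → ℝ) = w := by
          ext i
          fin_cases i <;> simp
        rw [this, h] at h3
        simpa using h3.symm
      · intro i hi
        rw [(hc i (d + 1 - i) (by have := Finset.mem_range.1 hi; omega)).map_zero
          (by have := Finset.mem_range.1 hi; omega), mul_zero]
    intro v
    have h3 := (hc (d + 1) 0 rfl).map_smul 0 v
    rw [zero_smul, h2] at h3
    simpa using h3.symm
  have hci : ∀ i ∈ Finset.range (d + 1), ∀ v : Fin 1 → ℝ,
      c i v = v 0 * (v 0 ^ (d - i) * c i 1) := by
    intro i hi v
    have hi' := Finset.mem_range.1 hi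
    have hv : v = v 0 • (1 : Fin 1 → ℝ) := by
      ext j
      fin_cases j
      simp
    conv_lhs => rw [hv, (hc i (d - i + 1) (by omega)).map_smul]
    ring
  have hs0 : IsForm 2 1 fun v => r⁻¹ * (w 0 * v 0 + w 1 * v 1) :=
    ((h0.const_mul _).add (h1.const_mul _)).const_mul _
  have hs1 : IsForm 2 1 fun v => r⁻¹ * perpForm w v := (isForm_perpForm w).const_mul _
  refine ⟨fun v => r⁻¹ * ∑ i ∈ Finset.range (d + 1), c i 1 *
    ((r⁻¹ * (w 0 * v 0 + w 1 * v 1)) ^ i * (r⁻¹ * perpForm w v) ^ (d - i)), ?_, fun v => ?_⟩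
  · refine IsForm.const_mul (IsForm.sum _ fun i hi => ?_) _
    have hi' := Finset.mem_range.1 hi
    have := ((hs0.pow i).mul (hs1.pow (d - i))).const_mul (c i 1)
    rwa [one_mul, one_mul, show i + (d - i) = d by omega] at this
  · have h3 := hfc (r⁻¹ * (w 0 * v 0 + w 1 * v 1)) fun _ => r⁻¹ * perpForm w v
    rw [Finset.sum_range_succ, hlast, mul_zero, add_zero,
      Finset.sum_congr rfl fun i hi => by rw [hci i hi]] at h3
    rw [mul_left_comm, ← mul_assoc, Finset.mul_sum]
    convert h3 using 1
    · congr 1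
      ext i
      fin_cases i
      · simp [perpForm]
        field_simp
        rw [hrdef]
        ring
      · simp [perpForm]
        field_simp
        rw [hrdef]
        ring
    · refine Finset.sum_congr rfl fun i hi => by ring

theorem IsForm.exists_eq_perpForm_sq_mul {d : ℕ} {f : (Fin 2 → ℝ) → ℝ} (hf : IsForm 2 (d + 2) f)
    {w : Fin 2 → ℝ} (hw : w ≠ 0) (h : f w = 0) (hnonneg : ∀ v, 0 ≤ f v) :
    ∃ g, IsForm 2 d g ∧ (∀ v, f v = perpForm w v ^ 2 * g v) ∧ ∀ v, 0 ≤ g v := by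
  obtain ⟨g₁, hg₁, hfg₁⟩ := hf.exists_eq_perpForm_mul hw h
  have hr := normSq_pos_of_ne_zero hw
  have hg₁w : g₁ w = 0 := by
    have := hg₁.continuous
    have h1 := eq_zero_of_mul_nonneg (φ := fun t => g₁ (w + t • ![-w 1, w 0])) (by fun_prop)
      fun t => by
        have h2 := hnonneg (w + t • ![-w 1, w 0])
        rw [hfg₁, perpForm_add_smul, show perpForm w w = 0 by unfold perpForm; ring, zero_add,
          mul_right_comm] at h2
        exact nonneg_of_mul_nonneg_left h2 hr
    simpa using h1
  obtain ⟨g, hg, hg₁g⟩ := hg₁.exists_eq_perpForm_mul hw hg₁w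
  have hfg : ∀ v, f v = perpForm w v ^ 2 * g v := fun v => by rw [hfg₁, hg₁g]; ring
  refine ⟨g, hg, hfg, nonneg_of_perpForm_ne_zero hg.continuous hw fun v hv => ?_⟩
  have := hnonneg v
  rw [hfg] at this
  exact nonneg_of_mul_nonneg_right this (by positivity)

theorem hasSquareMinorant_one {d : ℕ} (hd : 0 < d) {f : (Fin 1 → ℝ) → ℝ} (hf : IsForm 1 (2 * d) f)
    (hnonneg : ∀ v, 0 ≤ f v) (hne : ∃ v, f v ≠ 0) : HasSquareMinorant 1 d f := by
  have h1 : ∀ v, f v = v 0 ^ (2 * d) * f 1 := fun v => by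
    rw [← hf.map_smul]
    congr 1
    ext i
    fin_cases i
    simp
  refine hasSquareMinorant_of_pos one_pos hd hf fun v hv => ?_
  have hf1 : 0 < f 1 := by
    refine (hnonneg 1).lt_of_ne' fun h => ?_
    obtain ⟨v, hv⟩ := hne
    exact hv (by rw [h1, h, mul_zero])
  have hv0 : v 0 ≠ 0 := fun h => hv (by ext i; fin_cases i; simpa using h)
  rw [h1, pow_mul]
  positivity

theorem hasSquareMinorant_two {d : ℕ} {f : (Fin 2 → ℝ) → ℝ} (hf : IsForm 2 (2 * d) f)
    (hnonneg : ∀ v, 0 ≤ f v) (hne : ∃ v, f v ≠ 0) : HasSquareMinorant 2 d f := by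
  induction d generalizing f with
  | zero =>
    have h1 : ∀ v, f v = f 0 := fun v => by simpa using (hf.map_smul 0 v).symm
    obtain ⟨v, hv⟩ := hne
    refine ⟨fun _ => √(f 0), IsForm.const _, ⟨0, ?_⟩, fun v => ?_⟩
    · rw [h1] at hv
      exact (Real.sqrt_pos.2 ((hnonneg 0).lt_of_ne' hv)).ne'
    · rw [Real.sq_sqrt (hnonneg 0), h1 v]
  | succ d ih =>
    by_cases hpos : ∀ v, v ≠ 0 → 0 < f v
    · exact hasSquareMinorant_of_pos two_pos d.succ_pos hf hpos
    push Not at hpos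
    obtain ⟨w, hw, hfw⟩ := hpos
    obtain ⟨g, hg, hfg, hg0⟩ := IsForm.exists_eq_perpForm_sq_mul (d := 2 * d) hf hw
      (le_antisymm hfw (hnonneg w)) hnonneg
    obtain ⟨q, hq, hq0, hqg⟩ := ih hg hg0 (by
      obtain ⟨v, hv⟩ := hne
      exact ⟨v, fun h => hv (by rw [hfg, h, mul_zero])⟩)
    refine ⟨fun v => perpForm w v * q v, ?_,
      (isForm_perpForm w).exists_mul_ne_zero hq (exists_perpForm_ne_zero hw) hq0, fun v => ?_⟩
    · rw [add_comm d 1]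
      exact (isForm_perpForm w).mul hq
    · rw [hfg, mul_pow]
      exact mul_le_mul_of_nonneg_left (hqg v) (sq_nonneg _)

theorem quadratic_nonneg {a b c : ℝ} (h : ∀ x : ℝ, 0 ≤ x ^ 2 * a + 2 * x * b + c) :
    0 ≤ a ∧ 0 ≤ c ∧ b ^ 2 ≤ a * c := by
  have ha := nonneg_of_ne_zero (φ := fun t => a + 2 * t * b + t ^ 2 * c) (by fun_prop)
    (fun t ht => by
      have h1 := mul_nonneg (sq_nonneg t) (h t⁻¹)
      have h2 : t ^ 2 * (t⁻¹ ^ 2 * a + 2 * t⁻¹ * b + c) = a + 2 * t * b + t ^ 2 * c := by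
        field_simp
      rwa [h2] at h1) 0
  have hc := h 0
  simp only [ne_eq, OfNat.ofNat_ne_zero, not_false_eq_true, zero_pow, zero_mul, mul_zero,
    add_zero, zero_add] at ha hc
  refine ⟨ha, hc, ?_⟩
  rcases ha.eq_or_lt with rfl | ha
  · by_contra! hb
    have hb0 : b ≠ 0 := by rintro rfl; simp at hb
    have h1 := h (-(c + 1) / (2 * b))
    have : (-(c + 1) / (2 * b)) ^ 2 * 0 + 2 * (-(c + 1) / (2 * b)) * b + c = -1 := by
      field_simp
      ring
    linarith
  · have h1 := h (-b / a)
    have : (-b / a) ^ 2 * a + 2 * (-b / a) * b + c = (a * c - b ^ 2) / a := by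
      field_simp
      ring
    rw [this] at h1
    have := (div_nonneg_iff.1 h1)
    rcases this with h2 | h2
    · linarith [h2.1]
    · linarith [h2.2]

theorem exists_linearEquiv_apply_single {n : ℕ} {v : Fin (n + 1) → ℝ} (hv : v ≠ 0) :
    ∃ T : (Fin (n + 1) → ℝ) ≃ₗ[ℝ] Fin (n + 1) → ℝ, T (Fin.cons 1 0) = v := by
  obtain ⟨A, hA⟩ := SeparatingDual.exists_continuousLinearEquiv_apply_eq (R := ℝ)
    (x := (Fin.cons 1 0 : Fin (n + 1) → ℝ)) (y := v) (fun h => by simpa using congrFun h 0) hv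
  exact ⟨A.toLinearEquiv, hA⟩

theorem hasSquareMinorant_quadratic {n : ℕ} {f : (Fin n → ℝ) → ℝ} (hf : IsForm n 2 f)
    (hnonneg : ∀ v, 0 ≤ f v) (hne : ∃ v, f v ≠ 0) : HasSquareMinorant n 1 f := by
  obtain ⟨u, hu⟩ := hne
  have hu0 : u ≠ 0 := by
    rintro rfl
    exact hu (hf.map_zero two_ne_zero)
  obtain _ | n := n
  · exact absurd (Subsingleton.elim _ _) hu0
  obtain ⟨T, hT⟩ := exists_linearEquiv_apply_single hu0
  refine .of_comp T ?_
  obtain ⟨c, hc, hfc⟩ := (hf.comp_linear T.toLinearMap).exists_expansion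
  simp only [LinearEquiv.coe_coe, Finset.sum_range_succ, Finset.range_zero, Finset.sum_empty,
    pow_zero, one_mul, zero_add, pow_one] at hfc
  have hc2 : ∀ v, c 2 v = c 2 0 := fun v => by simpa using ((hc 2 0 rfl).map_smul 0 v).symm
  have hc20 : f u = c 2 0 := by
    rw [← hT, hfc, (hc 0 2 rfl).map_zero two_ne_zero, (hc 1 1 rfl).map_zero one_ne_zero]
    simp
  have hpos : 0 < c 2 0 := hc20 ▸ (hnonneg u).lt_of_ne' hu
  refine .of_le_mul hpos (q := fun v => c 2 0 * v 0 + 1 / 2 * c 1 (Fin.tail v))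
    (((IsForm.coord 0).const_mul _).add ((hc 1 1 rfl).tail.const_mul _))
    ⟨Fin.cons 1 0, ?_⟩ fun v => ?_
  · rw [Fin.tail_cons, (hc 1 1 rfl).map_zero one_ne_zero]
    simpa using hpos.ne'
  · rw [← Fin.cons_self_tail v, hfc, Fin.tail_cons, Fin.cons_zero, hc2 (Fin.tail v)]
    have h2 := (quadratic_nonneg (a := c 2 0) (b := c 1 (Fin.tail v) / 2)
      (c := c 0 (Fin.tail v)) fun x => by
        have := hnonneg (T (Fin.cons x (Fin.tail v)))
        rw [hfc, hc2 (Fin.tail v)] at this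
        linarith).2.2
    nlinarith

/-- The function `F` dominates the square of a nonzero ternary quadratic form, up to scaling. -/
def HasTernaryMinorant (F : ℝ → (Fin 2 → ℝ) → ℝ) : Prop :=
  ∃ (r C : ℝ) (l s : (Fin 2 → ℝ) → ℝ), 0 < C ∧ IsForm 2 1 l ∧ IsForm 2 2 s ∧
    (∃ x v, r * x ^ 2 + x * l v + s v ≠ 0) ∧ ∀ x v, (r * x ^ 2 + x * l v + s v) ^ 2 ≤ C * F x v

theorem HasTernaryMinorant.of_shear {F : ℝ → (Fin 2 → ℝ) → ℝ} {t : (Fin 2 → ℝ) → ℝ}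
    (ht : IsForm 2 1 t) (h : HasTernaryMinorant fun x v => F (x + t v) v) :
    HasTernaryMinorant F := by
  obtain ⟨r, C, l, s, hC, hl, hs, ⟨x, v, hxv⟩, hF⟩ := h
  have key : ∀ x v, r * x ^ 2 + x * (l v - 2 * r * t v) + (s v - t v * l v + r * (t v * t v)) =
      r * (x - t v) ^ 2 + (x - t v) * l v + s v := fun x v => by ring
  refine ⟨r, C, fun v => l v - 2 * r * t v, fun v => s v - t v * l v + r * (t v * t v), hC,
    hl.sub (ht.const_mul _), (hs.sub (ht.mul hl)).add ((ht.mul ht).const_mul _),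
    ⟨x + t v, v, ?_⟩, fun x v => ?_⟩
  · rw [key]
    simpa using hxv
  · rw [key]
    simpa using hF (x - t v) v

theorem IsForm.eq_const {n : ℕ} {f : (Fin n → ℝ) → ℝ} (hf : IsForm n 0 f) (v : Fin n → ℝ) :
    f v = f 0 := by
  simpa using (hf.map_smul 0 v).symm

theorem hasTernaryMinorant_of_two_zeros {f g h : (Fin 2 → ℝ) → ℝ} (hf : IsForm 2 2 f)
    (hg : IsForm 2 2 g) (hh : IsForm 2 2 h) (hpos : ∀ v, v ≠ 0 → 0 < f v) {w : Fin 2 → ℝ}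
    (hw : w ≠ 0)
    (hF : ∀ x v, 0 ≤ x ^ 2 * f v + 2 * x * (perpForm w v * g v) + perpForm w v ^ 2 * h v) :
    HasTernaryMinorant fun x v =>
      x ^ 2 * f v + 2 * x * (perpForm w v * g v) + perpForm w v ^ 2 * h v := by
  have hcf := hf.continuous
  have hcg := hg.continuous
  have hch := hh.continuous
  have hℓ := isForm_perpForm w
  have hD : ∀ v, 0 ≤ f v * h v - g v * g v :=
    nonneg_of_perpForm_ne_zero (by fun_prop) hw fun v hv => by
      have h1 := (quadratic_nonneg fun x => hF x v).2.2
      refine nonneg_of_mul_nonneg_right (a := perpForm w v ^ 2) ?_ (by positivity)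
      linarith
  by_cases hDpos : ∀ v, v ≠ 0 → 0 < f v * h v - g v * g v
  · obtain ⟨C, hC, hCle⟩ := ((hf.mul hh).sub (hg.mul hg)).le_mul_of_pos
      ((hℓ.mul hℓ).mul hf) (by norm_num) hDpos
    obtain ⟨v₀, hv₀⟩ := exists_perpForm_ne_zero hw
    refine ⟨0, C, fun _ => 0, fun v => perpForm w v * perpForm w v, hC, IsForm.zero, hℓ.mul hℓ,
      ⟨0, v₀, by simpa using hv₀⟩, fun x v => ?_⟩
    simp only [zero_mul, mul_zero, zero_add]
    rcases eq_or_ne v 0 with rfl | hv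
    · rw [hℓ.map_zero one_ne_zero, hf.map_zero two_ne_zero]
      simp
    · have h1 := hCle v
      have h2 := mul_le_mul_of_nonneg_left h1 (sq_nonneg (perpForm w v))
      refine le_of_mul_le_mul_left ?_ (hpos v hv)
      have h3 := mul_nonneg hC.le (sq_nonneg (x * f v + perpForm w v * g v))
      linarith
  push Not at hDpos
  obtain ⟨w', hw', hDw'⟩ := hDpos
  have hfw' := hpos w' hw'
  have hDw'' : f w' * h w' - g w' * g w' = 0 := le_antisymm hDw' (hD w')
  set α := -g w' / f w' with hα
  have hαg : g w' = -α * f w' := by rw [hα]; field_simp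
  have hhw' : h w' = α ^ 2 * f w' := by
    rw [hαg] at hDw''
    have : f w' * (h w' - α ^ 2 * f w') = 0 := by linarith
    linarith [(mul_eq_zero.1 this).resolve_left hfw'.ne']
  have hG : IsForm 2 2 fun v => α * f v + g v := (hf.const_mul _).add hg
  have hH : IsForm 2 2 fun v => α ^ 2 * f v + 2 * α * g v + h v :=
    ((hf.const_mul _).add (hg.const_mul _)).add hh
  have hF' : ∀ x v, 0 ≤ x ^ 2 * f v + 2 * x * (perpForm w v * (α * f v + g v)) +
      perpForm w v ^ 2 * (α ^ 2 * f v + 2 * α * g v + h v) := fun x v => by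
    have := hF (x + α * perpForm w v) v
    linarith
  have hHnn : ∀ v, 0 ≤ α ^ 2 * f v + 2 * α * g v + h v :=
    nonneg_of_perpForm_ne_zero hH.continuous hw fun v hv => by
      have h1 := (quadratic_nonneg fun x => hF' x v).2.1
      exact nonneg_of_mul_nonneg_right h1 (by positivity)
  have hGH : ∀ v, (α * f v + g v) ^ 2 ≤ f v * (α ^ 2 * f v + 2 * α * g v + h v) := fun v => by
    have := hD v
    linarith
  obtain ⟨g₁, hg₁, hGg₁⟩ := hG.exists_eq_perpForm_mul hw' (by rw [hαg]; ring)
  obtain ⟨b, hb, hHb, hb0⟩ := hH.exists_eq_perpForm_sq_mul hw' (by rw [hhw', hαg]; ring) hHnn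
  refine .of_shear (t := fun v => α * perpForm w v) (hℓ.const_mul _) ?_
  have hrw : ∀ x v, (x + α * perpForm w v) ^ 2 * f v +
      2 * (x + α * perpForm w v) * (perpForm w v * g v) + perpForm w v ^ 2 * h v =
      x ^ 2 * f v + 2 * x * (perpForm w v * (perpForm w' v * g₁ v)) +
      perpForm w v ^ 2 * (perpForm w' v ^ 2 * b 0) := fun x v => by
    rw [← hGg₁, ← hb.eq_const v, ← hHb]
    ring
  simp only [hrw]
  have hGH' : ∀ v, (perpForm w' v * g₁ v) ^ 2 ≤ f v * (perpForm w' v ^ 2 * b 0) := fun v => by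
    rw [← hGg₁, ← hb.eq_const v, ← hHb]
    exact hGH v
  rcases (hb0 0).eq_or_lt with hb00 | hb00
  · have hg0 : ∀ v, perpForm w' v * g₁ v = 0 := fun v => by
      have := hGH' v
      rw [← hb00] at this
      exact pow_eq_zero_iff (n := 2) (by norm_num) |>.1 (le_antisymm (by linarith) (sq_nonneg _))
    obtain ⟨C, hC, hCle⟩ :=
      hf.le_mul_of_pos ((IsForm.coord 0).mul (IsForm.coord 0)) two_ne_zero hpos
    refine ⟨0, C, fun v => v 0, fun _ => 0, hC, IsForm.coord 0, IsForm.zero,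
      ⟨1, 1, by simp⟩, fun x v => ?_⟩
    beta_reduce
    rw [hg0, ← hb00]
    have := mul_le_mul_of_nonneg_left (hCle v) (sq_nonneg x)
    linarith
  · have hg₁f : ∀ v, 0 ≤ b 0 * f v - g₁ v * g₁ v := by
      have := hg₁.continuous
      refine nonneg_of_perpForm_ne_zero (by fun_prop) hw' fun v hv => ?_
      refine nonneg_of_mul_nonneg_right (a := perpForm w' v ^ 2) ?_ (by positivity)
      have := hGH' v
      linarith
    obtain ⟨v₀, hv₀⟩ := hℓ.exists_mul_ne_zero (isForm_perpForm w') (exists_perpForm_ne_zero hw)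
      (exists_perpForm_ne_zero hw')
    refine ⟨0, b 0, g₁, fun v => b 0 * (perpForm w v * perpForm w' v), hb00, hg₁,
      (hℓ.mul (isForm_perpForm w')).const_mul _, ⟨0, v₀, ?_⟩, fun x v => ?_⟩
    · simpa [hb00.ne'] using hv₀
    · have := mul_le_mul_of_nonneg_left (hg₁f v) (sq_nonneg x)
      linarith

theorem hasTernaryMinorant_of_zero {f g h : (Fin 2 → ℝ) → ℝ} (hf : IsForm 2 2 f)
    (hg : IsForm 2 3 g) (hh : IsForm 2 4 h) (hF : ∀ x v, 0 ≤ x ^ 2 * f v + 2 * x * g v + h v)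
    (hne : ∃ x v, x ^ 2 * f v + 2 * x * g v + h v ≠ 0) :
    HasTernaryMinorant fun x v => x ^ 2 * f v + 2 * x * g v + h v := by
  have hcg := hg.continuous
  have hch := hh.continuous
  have hfnn : ∀ v, 0 ≤ f v := fun v => (quadratic_nonneg fun x => hF x v).1
  have hhnn : ∀ v, 0 ≤ h v := fun v => (quadratic_nonneg fun x => hF x v).2.1
  have hD : ∀ v, g v ^ 2 ≤ f v * h v := fun v => (quadratic_nonneg fun x => hF x v).2.2
  by_cases hpos : ∀ v, v ≠ 0 → 0 < f v
  · by_cases hDpos : ∀ v, v ≠ 0 → 0 < f v * h v - g v * g v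
    · obtain ⟨C, hC, hCle⟩ := ((hf.mul hh).sub (hg.mul hg)).le_mul_of_pos
        ((hf.mul hf).mul hf) (by norm_num) hDpos
      refine ⟨0, C, fun _ => 0, f, hC, IsForm.zero, hf,
        ⟨0, 1, by simpa using (hpos 1 one_ne_zero).ne'⟩, fun x v => ?_⟩
      simp only [zero_mul, mul_zero, zero_add]
      rcases eq_or_ne v 0 with rfl | hv
      · have := hF x 0
        rw [hf.map_zero two_ne_zero] at *
        nlinarith
      · refine le_of_mul_le_mul_left ?_ (hpos v hv)
        have h1 := hCle v
        have h3 := mul_nonneg hC.le (sq_nonneg (x * f v + g v))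
        linarith
    push Not at hDpos
    obtain ⟨w, hw, hDw⟩ := hDpos
    have hfw := hpos w hw
    have hDw' : f w * h w - g w * g w = 0 := le_antisymm hDw (by linarith [hD w])
    set α := -g w / f w with hα
    have hαg : g w = -α * f w := by rw [hα]; field_simp
    have hhw : h w = α ^ 2 * f w := by
      rw [hαg] at hDw'
      have : f w * (h w - α ^ 2 * f w) = 0 := by linarith
      linarith [(mul_eq_zero.1 this).resolve_left hfw.ne']
    have hr := normSq_pos_of_ne_zero hw
    set t : (Fin 2 → ℝ) → ℝ := fun v => (α / (w 0 ^ 2 + w 1 ^ 2)) * (w 0 * v 0 + w 1 * v 1) with ht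
    have htf : IsForm 2 1 t :=
      (((IsForm.coord 0).const_mul _).add ((IsForm.coord 1).const_mul _)).const_mul _
    have htw : t w = α := by
      simp only [ht]
      field_simp
    have hG : IsForm 2 3 fun v => t v * f v + g v := (htf.mul hf).add hg
    have hH : IsForm 2 4 fun v => t v * (t v * f v) + 2 * (t v * g v) + h v :=
      ((htf.mul (htf.mul hf)).add ((htf.mul hg).const_mul 2)).add hh
    have hrw : ∀ x v, (x + t v) ^ 2 * f v + 2 * (x + t v) * g v + h v =
        x ^ 2 * f v + 2 * x * (t v * f v + g v) + (t v * (t v * f v) + 2 * (t v * g v) + h v) :=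
      fun x v => by ring
    have hF' := fun x v => (hrw x v) ▸ hF (x + t v) v
    obtain ⟨g₁, hg₁, hGg₁⟩ := hG.exists_eq_perpForm_mul hw (by rw [hαg, htw]; ring)
    obtain ⟨h₁, hh₁, hHh₁, -⟩ := hH.exists_eq_perpForm_sq_mul hw (by rw [hhw, hαg, htw]; ring)
      fun v => (quadratic_nonneg fun x => hF' x v).2.1
    refine .of_shear htf ?_
    simp only [hrw, hGg₁, hHh₁]
    exact hasTernaryMinorant_of_two_zeros hf hg₁ hh₁ hpos hw fun x v => by
      rw [← hGg₁, ← hHh₁]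
      exact hF' x v
  push Not at hpos
  obtain ⟨w, hw, hfw⟩ := hpos
  have hfw0 : f w = 0 := le_antisymm hfw (hfnn w)
  obtain ⟨a, ha, hfa, ha0⟩ := hf.exists_eq_perpForm_sq_mul hw hfw0 hfnn
  obtain ⟨g₁, hg₁, hgg₁⟩ := hg.exists_eq_perpForm_mul hw (by
    have := hD w
    rw [hfw0, zero_mul] at this
    exact pow_eq_zero_iff (n := 2) (by norm_num) |>.1 (le_antisymm this (sq_nonneg _)))
  rcases (ha0 0).eq_or_lt with ha00 | ha00
  · have hf0 : ∀ v, f v = 0 := fun v => by rw [hfa, ha.eq_const, ← ha00, mul_zero]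
    have hg0 : ∀ v, g v = 0 := fun v => by
      have := hD v
      rw [hf0, zero_mul] at this
      exact pow_eq_zero_iff (n := 2) (by norm_num) |>.1 (le_antisymm this (sq_nonneg _))
    simp only [hf0, hg0, mul_zero, zero_add] at hne ⊢
    obtain ⟨-, v, hv⟩ := hne
    obtain ⟨q, hq, ⟨u, hu⟩, hqh⟩ := hasSquareMinorant_two (d := 2) hh hhnn ⟨v, hv⟩
    exact ⟨0, 1, fun _ => 0, q, one_pos, IsForm.zero, hq, ⟨0, u, by simpa using hu⟩,
      fun x v => by simpa using hqh v⟩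
  · have hg₁h : ∀ v, 0 ≤ a 0 * h v - g₁ v * g₁ v := by
      have := hg₁.continuous
      refine nonneg_of_perpForm_ne_zero (by fun_prop) hw fun v hv => ?_
      refine nonneg_of_mul_nonneg_right (a := perpForm w v ^ 2) ?_ (by positivity)
      have := hD v
      rw [hgg₁, hfa, ha.eq_const v] at this
      linarith
    refine ⟨0, a 0, fun v => a 0 * perpForm w v, g₁, ha00, (isForm_perpForm w).const_mul _, hg₁,
      ?_, fun x v => ?_⟩
    · obtain ⟨v, hv⟩ := exists_perpForm_ne_zero hw
      by_cases hgv : g₁ v = 0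
      · exact ⟨1, v, by simpa [hgv] using ⟨ha00.ne', hv⟩⟩
      · exact ⟨0, v, by simpa using hgv⟩
    · have := hg₁h v
      beta_reduce
      rw [hgg₁, hfa, ha.eq_const v]
      linarith

theorem hasSquareMinorant_ternary_quartic {f : (Fin 3 → ℝ) → ℝ} (hf : IsForm 3 4 f)
    (hnonneg : ∀ v, 0 ≤ f v) (hne : ∃ v, f v ≠ 0) : HasSquareMinorant 3 2 f := by
  by_cases hpos : ∀ v, v ≠ 0 → 0 < f v
  · exact hasSquareMinorant_of_pos (d := 2) (by norm_num) two_pos hf hpos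
  push Not at hpos
  obtain ⟨u, hu, hfu⟩ := hpos
  obtain ⟨T, hT⟩ := exists_linearEquiv_apply_single hu
  refine .of_comp T ?_
  obtain ⟨c, hc, hfc⟩ := (hf.comp_linear T.toLinearMap).exists_expansion
  simp only [LinearEquiv.coe_coe, Finset.sum_range_succ, Finset.range_zero, Finset.sum_empty,
    pow_zero, one_mul, zero_add, pow_one] at hfc
  have h0 := hc 0 4 rfl
  have h1 := hc 1 3 rfl
  have h2 := hc 2 2 rfl
  have h3 := hc 3 1 rfl
  have hc4 : ∀ v, c 4 v = 0 := fun v => by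
    rw [(hc 4 0 rfl).eq_const]
    have := hfc 1 0
    rw [hT, h0.map_zero (by norm_num), h1.map_zero (by norm_num), h2.map_zero (by norm_num),
      h3.map_zero (by norm_num), le_antisymm hfu (hnonneg u)] at this
    linarith
  have hc3 : ∀ v, c 3 v = 0 := fun v => by
    have := eq_zero_of_mul_nonneg
      (φ := fun t => c 3 v + t * c 2 v + t ^ 2 * c 1 v + t ^ 3 * c 0 v) (by fun_prop) fun t => by
        have := hnonneg (T (Fin.cons 1 (t • v)))
        rw [hfc, h0.map_smul, h1.map_smul, h2.map_smul, h3.map_smul, hc4] at this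
        linarith
    simpa using this
  have hrw : ∀ x v, f (T (Fin.cons x v)) = x ^ 2 * c 2 v + 2 * x * (1 / 2 * c 1 v) + c 0 v :=
    fun x v => by
      rw [hfc, hc3, hc4]
      ring
  obtain ⟨r, C, l, s, hC, hl, hs, ⟨x, v, hxv⟩, hF⟩ := hasTernaryMinorant_of_zero h2
    (h1.const_mul (1 / 2)) h0 (fun x v => by rw [← hrw]; exact hnonneg _) (by
      obtain ⟨v, hv⟩ := hne
      refine ⟨T.symm v 0, Fin.tail (T.symm v), ?_⟩
      rw [← hrw, Fin.cons_self_tail]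
      simpa using hv)
  refine .of_le_mul hC (q := fun v => r * (v 0 * v 0) + v 0 * l (Fin.tail v) + s (Fin.tail v))
    ((((IsForm.coord 0).mul (IsForm.coord 0)).const_mul _).add
      ((IsForm.coord 0).mul hl.tail) |>.add hs.tail) ⟨Fin.cons x v, ?_⟩ fun v => ?_
  · simpa [pow_two] using hxv
  · have := hF (v 0) (Fin.tail v)
    beta_reduce at this
    rw [← hrw, Fin.cons_self_tail] at this
    rwa [← pow_two]

open Matrix in
theorem isSpectrahedralShadow_image_posSemidef {D N : ℕ} (hD : 0 < D)
    (L : Matrix (Fin D) (Fin D) ℝ →ₗ[ℝ] Fin N → ℝ)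
    (hL : ∀ ξ, ∃ G : Matrix (Fin D) (Fin D) ℝ, G.IsSymm ∧ L G = ξ) :
    IsSpectrahedralShadow {ξ | ∃ G : Matrix (Fin D) (Fin D) ℝ, G.PosSemidef ∧ L G = ξ} := by
  choose B hB hLB using fun i : Fin N => hL (Pi.single i 1)
  let S : Submodule ℝ (Matrix (Fin D) (Fin D) ℝ) :=
    LinearMap.ker L ⊓
      { carrier := {G | G.IsSymm}
        add_mem' := fun ha hb => ha.add hb
        zero_mem' := Matrix.isSymm_zero
        smul_mem' := fun c _ ha => ha.smul c }
  let b := Module.finBasis ℝ S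
  have hsum : ∀ ξ : Fin N → ℝ, L (∑ i, ξ i • B i) = ξ := fun ξ => by
    simp only [map_sum, map_smul, hLB]
    ext j
    simp [Finset.sum_apply, Pi.single_apply]
  have hsumS : ∀ ξ : Fin N → ℝ, (∑ i, ξ i • B i).IsSymm := fun ξ => by
    rw [Matrix.IsSymm, Matrix.transpose_sum]
    exact Finset.sum_congr rfl fun i _ => by rw [Matrix.transpose_smul, hB i]
  refine ⟨D, Module.finrank ℝ S, hD, 0, B, fun j => (b j : Matrix (Fin D) (Fin D) ℝ),
    Matrix.isSymm_zero, hB, fun j => (b j).2.2, ?_⟩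
  ext ξ
  constructor
  · rintro ⟨G, hG, hGξ⟩
    have hmem : G - ∑ i, ξ i • B i ∈ S :=
      ⟨LinearMap.mem_ker.2 (by rw [map_sub, hsum, hGξ, sub_self]),
        Matrix.IsSymm.sub (Matrix.posSemidef_real_iff.1 hG).1 (hsumS ξ)⟩
    refine ⟨b.repr ⟨_, hmem⟩, ?_⟩
    have h1 := congrArg Subtype.val (b.sum_repr ⟨_, hmem⟩)
    rw [Submodule.coe_sum] at h1
    simp only [Submodule.coe_smul] at h1
    rw [h1, zero_add, add_sub_cancel]
    exact hG
  · rintro ⟨η, hη⟩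
    refine ⟨_, hη, ?_⟩
    rw [zero_add, map_add, hsum, map_sum, Finset.sum_eq_zero, add_zero]
    intro j _
    rw [map_smul, LinearMap.mem_ker.1 (b j).2.1, smul_zero]

theorem exists_fin_monomials (n d : ℕ) (hn : 0 < n) :
    ∃ (D : ℕ) (u : Fin D → (Fin n →₀ ℕ)), 0 < D ∧ Function.Injective u ∧
      Set.range u = {α : Fin n →₀ ℕ | ∑ i, α i = d} := by
  have hfin : {α : Fin n →₀ ℕ | ∑ i, α i = d}.Finite := by
    simp only [← Finsupp.degree_eq_sum]
    exact Finsupp.finite_of_degree_eq d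
  have := hfin.fintype
  have e := Fintype.equivFin {α : Fin n →₀ ℕ | ∑ i, α i = d}
  refine ⟨_, fun k => (e.symm k : Fin n →₀ ℕ), ?_, Subtype.val_injective.comp e.symm.injective, ?_⟩
  · refine Fintype.card_pos_iff.2 ⟨⟨Finsupp.single ⟨0, hn⟩ d, ?_⟩⟩
    rw [Set.mem_ofPred_eq, ← Finsupp.degree_eq_sum, Finsupp.degree_single]
  · rw [Set.range_comp' Subtype.val e.symm, e.symm.surjective.range_eq]
    simp

open MvPolynomial in
theorem eq_zero_of_sum_mono_eq_zero {n N : ℕ} {mono : Fin N → (Fin n →₀ ℕ)}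
    (hinj : Function.Injective mono) {a : Fin N → ℝ}
    (h : ∀ v : Fin n → ℝ, ∑ j, a j * ∏ i, v i ^ mono j i = 0) : a = 0 := by
  classical
  have h1 : ∑ j, monomial (mono j) (a j) = 0 := MvPolynomial.funext fun v => by
    simp only [map_sum, eval_monomial, Finsupp.prod_fintype _ _ (fun i => pow_zero _), map_zero, h]
  ext j
  have h2 := congrArg (coeff (mono j)) h1
  simpa [coeff_sum, coeff_monomial, hinj.eq_iff] using h2

/-- The quadratic form of a bounded family of matrices is bounded at every vector once it is bounded
on a spanning set. -/
theorem exists_bound_dotProduct_mulVec {D : ℕ} {X : Type*} (w : X → Fin D → ℝ) (f : X → ℝ)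
    (hw : ∀ b : Fin D → ℝ, (∀ x, ∑ k, b k * w x k = 0) → b = 0) (y : Fin D → ℝ) :
    ∃ C : ℝ, ∀ G : Matrix (Fin D) (Fin D) ℝ, G.PosSemidef →
      (∀ x, dotProduct (w x) (G.mulVec (w x)) ≤ f x) → dotProduct y (G.mulVec y) ≤ C := by
  have htop : Submodule.span ℝ (Set.range w) = ⊤ := by
    by_contra hne
    obtain ⟨φ, hφ, hφw⟩ := Submodule.exists_dual_map_eq_bot_of_lt_top (lt_top_iff_ne_top.2 hne)
      inferInstance
    have hφx : ∀ y : Fin D → ℝ, φ y = ∑ k, φ (Pi.single k 1) * y k := fun y => by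
      conv_lhs => rw [← Finset.univ_sum_single y, map_sum]
      refine Finset.sum_congr rfl fun k _ => ?_
      have : (Pi.single k (y k) : Fin D → ℝ) = y k • Pi.single k 1 := by
        rw [← Pi.single_smul, smul_eq_mul, mul_one]
      rw [this, map_smul, smul_eq_mul, mul_comm]
    have h0 := hw (fun k => φ (Pi.single k 1)) fun x => by
      rw [← hφx, ← Submodule.mem_bot ℝ, ← hφw]
      exact Submodule.mem_map_of_mem (Submodule.subset_span ⟨x, rfl⟩)
    apply hφ
    refine LinearMap.ext fun y => ?_
    rw [hφx, LinearMap.zero_apply]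
    exact Finset.sum_eq_zero fun k _ => by rw [congrFun h0 k, Pi.zero_apply, zero_mul]
  have hy : y ∈ Submodule.span ℝ (Set.range w) := htop ▸ Submodule.mem_top
  induction hy using Submodule.span_induction with
  | mem y hy =>
    obtain ⟨x, rfl⟩ := hy
    exact ⟨f x, fun G _ h => h x⟩
  | zero => exact ⟨0, fun G _ _ => by simp⟩
  | add y z _ _ hy hz =>
    obtain ⟨Cy, hCy⟩ := hy
    obtain ⟨Cz, hCz⟩ := hz
    refine ⟨2 * Cy + 2 * Cz, fun G hG h => ?_⟩
    have h1 := hCy G hG h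
    have h2 := hCz G hG h
    have h3 := (Matrix.posSemidef_real_iff.1 hG).2 (y - z)
    simp only [sub_eq_add_neg, Matrix.mulVec_add, Matrix.mulVec_neg, add_dotProduct, dotProduct_add,
      neg_dotProduct, dotProduct_neg] at h3 ⊢
    linarith
  | smul c y _ hy =>
    obtain ⟨C, hC⟩ := hy
    refine ⟨c ^ 2 * C, fun G hG h => ?_⟩
    have h1 := mul_le_mul_of_nonneg_left (hC G hG h) (sq_nonneg c)
    simp only [Matrix.mulVec_smul, smul_dotProduct, dotProduct_smul, smul_eq_mul]
    linarith

theorem isCompact_posSemidef_dotProduct_le {D : ℕ} {X : Type*} (w : X → Fin D → ℝ) (f : X → ℝ)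
    (hw : ∀ b : Fin D → ℝ, (∀ x, ∑ k, b k * w x k = 0) → b = 0) :
    IsCompact {G : Matrix (Fin D) (Fin D) ℝ | G.PosSemidef ∧
      ∀ x, dotProduct (w x) (G.mulVec (w x)) ≤ f x} := by
  choose C hC using exists_bound_dotProduct_mulVec w f hw
  let e : Fin D → Fin D → ℝ := fun k => Pi.single k 1
  have hcomp : IsCompact (Set.pi Set.univ fun k : Fin D => Set.pi Set.univ fun l : Fin D =>
      Set.Icc (-(C (e k) + C (e l))) (C (e k + e l))) :=
    isCompact_univ_pi fun k => isCompact_univ_pi fun l => isCompact_Icc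
  refine IsCompact.of_isClosed_subset hcomp ?_ ?_
  · have h1 : {G : Matrix (Fin D) (Fin D) ℝ | G.PosSemidef ∧
        ∀ x, dotProduct (w x) (G.mulVec (w x)) ≤ f x} =
        {G | G.transpose = G} ∩ (⋂ v, {G | 0 ≤ dotProduct v (G.mulVec v)}) ∩
          ⋂ x, {G | dotProduct (w x) (G.mulVec (w x)) ≤ f x} := by
      ext G
      simp only [Set.mem_ofPred_eq, Set.mem_inter_iff, Set.mem_iInter, Matrix.posSemidef_real_iff]
    rw [h1]
    have hc : ∀ v : Fin D → ℝ,
        Continuous fun G : Matrix (Fin D) (Fin D) ℝ => dotProduct v (G.mulVec v) :=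
      fun v => continuous_const.dotProduct (continuous_id.matrix_mulVec continuous_const)
    exact ((isClosed_eq continuous_id.matrix_transpose continuous_id).inter
      (isClosed_iInter fun v => isClosed_le continuous_const (hc v))).inter
      (isClosed_iInter fun x => isClosed_le (hc _) continuous_const)
  · rintro G ⟨hG, h⟩
    intro k _ l _
    change G k l ∈ Set.Icc (-(C (e k) + C (e l))) (C (e k + e l))
    have hs := fun i j => congrFun (congrFun (Matrix.posSemidef_real_iff.1 hG).1 i) j
    have hnn := (Matrix.posSemidef_real_iff.1 hG).2
    have hk := hC (e k) G hG h
    have hl := hC (e l) G hG h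
    have hkl := hC (e k + e l) G hG h
    have h1 := hnn (e k)
    have h2 := hnn (e l)
    have h3 := hnn (e k + e l)
    have h4 := hs k l
    simp only [e, Matrix.mulVec_add, add_dotProduct, dotProduct_add, Matrix.mulVec_single_one,
      single_one_dotProduct, Matrix.col_apply, Matrix.transpose_apply] at hk hl hkl h1 h2 h3 h4 ⊢
    constructor <;> linarith

theorem isSpectrahedralShadow_of_hasSquareMinorant {n d N : ℕ} (hn : 0 < n)
    {mono : Fin N → (Fin n →₀ ℕ)} (hinj : Function.Injective mono)
    (hrange : Set.range mono = {α : Fin n →₀ ℕ | ∑ i, α i = 2 * d}) {P : Set (Fin N → ℝ)}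
    (hP : P = {c : Fin N → ℝ | ∀ ξ : Fin n → ℝ, 0 ≤ ∑ j, c j * ∏ i, ξ i ^ mono j i})
    (hmin : ∀ f : (Fin n → ℝ) → ℝ, IsForm n (2 * d) f → (∀ v, 0 ≤ f v) → (∃ v, f v ≠ 0) →
      HasSquareMinorant n d f) : IsSpectrahedralShadow P := by
  classical
  obtain ⟨D, u, hD, hu, hurange⟩ := exists_fin_monomials n d hn
  have hsplit : ∀ j, ∃ k l, u k + u l = mono j := fun j => by
    have h1 : mono j ∈ {α : Fin n →₀ ℕ | ∑ i, α i = 2 * d} := hrange ▸ Set.mem_range_self j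
    rw [Set.mem_ofPred_eq, ← Finsupp.degree_eq_sum] at h1
    obtain ⟨β, hβ, hβd⟩ := Finsupp.exists_le_degree_eq (mono j) d (by omega)
    have h2 : (mono j - β).degree = d := by
      have h3 := congrArg Finsupp.degree (add_tsub_cancel_of_le hβ)
      rw [map_add] at h3
      omega
    have hmem : ∀ γ : Fin n →₀ ℕ, γ.degree = d → ∃ k, u k = γ := fun γ hγ => by
      have : γ ∈ Set.range u := by
        rw [hurange, Set.mem_ofPred_eq, ← Finsupp.degree_eq_sum, hγ]
      exact this
    obtain ⟨k, hk⟩ := hmem β hβd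
    obtain ⟨l, hl⟩ := hmem _ h2
    exact ⟨k, l, by rw [hk, hl, add_tsub_cancel_of_le hβ]⟩
  have hjoin : ∀ k l, ∃ j, mono j = u k + u l := fun k l => by
    have h1 : ∀ k, ∑ i, u k i = d := fun k => by
      have : u k ∈ {α : Fin n →₀ ℕ | ∑ i, α i = d} := hurange ▸ Set.mem_range_self k
      exact this
    have : u k + u l ∈ Set.range mono := by
      rw [hrange, Set.mem_ofPred_eq]
      simp only [Finsupp.add_apply, Finset.sum_add_distrib, h1]
      omega
    exact this
  choose J hJ using hjoin
  let m : (Fin n → ℝ) → Fin D → ℝ := fun v k => ∏ i, v i ^ u k i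
  have hm : ∀ v k l, m v k * m v l = ∏ i, v i ^ mono (J k l) i := fun v k l => by
    simp only [m, ← Finset.prod_mul_distrib, ← pow_add, hJ, Finsupp.add_apply]
  let L : Matrix (Fin D) (Fin D) ℝ →ₗ[ℝ] Fin N → ℝ :=
    { toFun := fun G j => ∑ k, ∑ l, if J k l = j then G k l else 0
      map_add' := fun G H => by
        ext j
        simp only [Pi.add_apply, ← Finset.sum_add_distrib]
        exact Finset.sum_congr rfl fun k _ => Finset.sum_congr rfl fun l _ => by
          split <;> simp
      map_smul' := fun c G => by
        ext j
        simp only [Pi.smul_apply, smul_eq_mul, RingHom.id_apply, Finset.mul_sum]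
        exact Finset.sum_congr rfl fun k _ => Finset.sum_congr rfl fun l _ => by
          split <;> simp }
  have hL : ∀ G v, ∑ j, L G j * ∏ i, v i ^ mono j i = dotProduct (m v) (G.mulVec (m v)) := by
    intro G v
    simp only [L, LinearMap.coe_mk, AddHom.coe_mk, dotProduct, Matrix.mulVec, Finset.sum_mul,
      Finset.mul_sum]
    rw [Finset.sum_comm]
    refine Finset.sum_congr rfl fun k _ => ?_
    rw [Finset.sum_comm]
    refine Finset.sum_congr rfl fun l _ => ?_
    simp only [ite_mul, zero_mul, Finset.sum_ite_eq, Finset.mem_univ, if_true]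
    rw [← hm]
    ring
  have hLform : ∀ c : Fin N → ℝ, IsForm n (2 * d) fun v => ∑ j, c j * ∏ i, v i ^ mono j i := by
    intro c
    refine IsForm.sum _ fun j _ => IsForm.const_mul ⟨MvPolynomial.monomial (mono j) 1, ?_,
      fun v => ?_⟩ _
    · refine MvPolynomial.isHomogeneous_monomial _ ?_
      have h1 : mono j ∈ {α : Fin n →₀ ℕ | ∑ i, α i = 2 * d} := hrange ▸ Set.mem_range_self j
      rw [Finsupp.degree_eq_sum]
      exact h1
    · rw [MvPolynomial.eval_monomial, Finsupp.prod_fintype _ _ fun i => pow_zero _, one_mul]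
  have hPim : P = {ξ | ∃ G : Matrix (Fin D) (Fin D) ℝ, G.PosSemidef ∧ L G = ξ} := by
    rw [hP]
    ext c
    constructor
    · intro hc
      have hcomp := isCompact_posSemidef_dotProduct_le m (fun v => ∑ j, c j * ∏ i, v i ^ mono j i)
        fun b hb => eq_zero_of_sum_mono_eq_zero hu hb
      obtain ⟨G, ⟨hG, hGc⟩, hmax⟩ := hcomp.exists_isMaxOn
        ⟨0, Matrix.PosSemidef.zero, fun v => by simpa using hc v⟩
        (continuous_id.matrix_trace).continuousOn
      refine ⟨G, hG, ?_⟩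
      by_contra hne
      have hdiff : ∀ v, ∑ j, (c - L G) j * ∏ i, v i ^ mono j i =
          ∑ j, c j * ∏ i, v i ^ mono j i - dotProduct (m v) (G.mulVec (m v)) := fun v => by
        rw [← hL, ← Finset.sum_sub_distrib]
        exact Finset.sum_congr rfl fun j _ => by rw [Pi.sub_apply, sub_mul]
      obtain ⟨q, ⟨p, hp, hpq⟩, ⟨v₀, hv₀⟩, hq⟩ := hmin _ (hLform (c - L G))
        (fun v => by rw [hdiff]; exact sub_nonneg.2 (hGc v)) (by
          by_contra! h
          exact hne (sub_eq_zero.1 (eq_zero_of_sum_mono_eq_zero hinj h)).symm)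
      set b : Fin D → ℝ := fun k => p.coeff (u k)
      have hqb : ∀ v, q v = dotProduct b (m v) := fun v => by
        rw [← hpq, ← MvPolynomial.coe_aeval_eq_eval, RingHom.coe_coe,
          aeval_eq_sum_mono_of_isHomogeneous hu hurange hp v]
        rfl
      have hbb : (Matrix.vecMulVec b b).PosSemidef := by
        simpa using Matrix.posSemidef_vecMulVec_self_star b
      have h1 := hmax (show G + Matrix.vecMulVec b b ∈ _ from ⟨hG.add hbb, fun v => by
        have h2 := hq v
        beta_reduce at h2
        rw [hdiff, hqb] at h2
        rw [Matrix.add_mulVec, dotProduct_add, Matrix.vecMulVec_mulVec, dotProduct_smul,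
          dotProduct_comm (m v) b]
        simp only [MulOpposite.smul_eq_mul_unop, MulOpposite.unop_op]
        linarith⟩)
      simp only [id, Set.mem_ofPred_eq, Matrix.trace_add, Matrix.trace_vecMulVec] at h1
      have h3 : dotProduct b b = 0 := le_antisymm (by linarith)
        (Finset.sum_nonneg fun k _ => mul_self_nonneg _)
      rw [dotProduct_self_eq_zero] at h3
      exact hv₀ (by rw [hqb, h3, zero_dotProduct])
    · rintro ⟨G, hG, rfl⟩ v
      rw [hL]
      exact (Matrix.posSemidef_real_iff.1 hG).2 _
  rw [hPim]
  refine isSpectrahedralShadow_image_posSemidef hD L fun ξ => ?_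
  choose k l hkl using hsplit
  have hJkl : ∀ j, J (k j) (l j) = j ∧ J (l j) (k j) = j := fun j =>
    ⟨hinj (by rw [hJ, hkl]), hinj (by rw [hJ, add_comm, hkl])⟩
  have hLs : ∀ a b, L (Matrix.single a b 1) = Pi.single (J a b) 1 := fun a b => by
    ext j
    simp only [L, LinearMap.coe_mk, AddHom.coe_mk, Matrix.single_apply, Pi.single_apply]
    rw [Finset.sum_eq_single a, Finset.sum_eq_single b]
    · simp [eq_comm]
    · intro b' _ hb'
      simp [hb'.symm]
    · simp
    · intro a' _ ha'
      exact Finset.sum_eq_zero fun b' _ => by simp [ha'.symm]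
    · simp
  refine ⟨∑ j, (ξ j / 2) • (Matrix.single (k j) (l j) 1 + Matrix.single (l j) (k j) 1), ?_, ?_⟩
  · rw [Matrix.IsSymm, Matrix.transpose_sum]
    exact Finset.sum_congr rfl fun j _ => by
      rw [Matrix.transpose_smul, Matrix.transpose_add, Matrix.transpose_single,
        Matrix.transpose_single, add_comm]
  · simp only [map_sum, map_smul, map_add, hLs, hJkl]
    ext i
    rw [Finset.sum_apply, Finset.sum_eq_single i]
    · simp
      ring
    · intro j _ hj
      simp [hj.symm]
    · simp

/-- the cone of nonnegative forms of degree `2d` in `n` variables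
(identified with its set of coefficient vectors in `ℝ^N`) is a spectrahedral shadow
iff `2d = 2`, `n ≤ 2` or `(n, 2d) = (3, 4)`. -/
theorem psdCone_isSpectrahedralShadow_iff
    (n d : ℕ) (hn : 0 < n) (hd : 0 < d)
    (N : ℕ) (hN : N = (n + 2 * d - 1).choose (n - 1))
    (mono : Fin N → (Fin n →₀ ℕ)) (hinj : Function.Injective mono)
    (hrange : Set.range mono = {α : Fin n →₀ ℕ | ∑ i, α i = 2 * d})
    (P : Set (Fin N → ℝ))
    (hP : P = {c : Fin N → ℝ | ∀ ξ : Fin n → ℝ, 0 ≤ ∑ j, c j * ∏ i, ξ i ^ mono j i}) :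
    IsSpectrahedralShadow P ↔ (2 * d = 2 ∨ n ≤ 2 ∨ (n = 3 ∧ 2 * d = 4)) := by
  constructor
  · intro hsh
    by_contra hcase
    rcases (by omega : 3 ≤ n ∧ 3 ≤ d ∨ 4 ≤ n ∧ 2 ≤ d) with ⟨h1, h2⟩ | ⟨h1, h2⟩
    · exact not_isSpectrahedralShadow_of_three_le h1 h2 hinj hrange hP hsh
    · exact not_isSpectrahedralShadow_of_four_le h1 h2 hinj hrange hP hsh
  · intro hcase
    refine isSpectrahedralShadow_of_hasSquareMinorant hn hinj hrange hP fun f hf hnonneg hne => ?_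
    obtain rfl | rfl | rfl | ⟨rfl, rfl⟩ : d = 1 ∨ n = 1 ∨ n = 2 ∨ n = 3 ∧ d = 2 := by omega
    · exact hasSquareMinorant_quadratic hf hnonneg hne
    · exact hasSquareMinorant_one hd hf hnonneg hne
    · exact hasSquareMinorant_two hf hnonneg hne
    · exact hasSquareMinorant_ternary_quartic hf hnonneg hne
end

section
/- Let A be a regular local ring that is an ℝ-algebra whose residue field is ℝ (i.e., the composite ℝ → A → A/m is an isomorphism, where m is the maximal ideal of A), and let p_1, …, p_d be a regular system of parameters of A (a sequence of d = dim A elements generating m). If f ∈ ℝ[x_1, …, x_d] is a homogeneous polynomial that is not a sum of squares in ℝ[x_1,…,x_d], then f(p_1, …, p_d) is not a sum of squares in A. -/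
open IsLocalRing

theorem IsSumSq.map_ringHom {R S : Type*} [Semiring R] [Semiring S] (φ : R →+* S) {a : R}
    (ha : IsSumSq a) : IsSumSq (φ a) := by
  induction ha with
  | zero => simp
  | sq_add b _ ih =>
    rw [map_add, map_mul]
    exact .sq_add _ ih

namespace MvPolynomial

theorem IsHomogeneous.aeval_mul_algebraMap {σ K B : Type*} [CommRing K] [CommRing B] [Algebra K B]
    {n : ℕ} {g : MvPolynomial σ K} (hg : g.IsHomogeneous n) (t : B) (c : σ → K) :
    MvPolynomial.aeval (fun i ↦ t * algebraMap K B (c i)) g = t ^ n * algebraMap K B (eval c g) := by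
  rw [aeval_def, eval₂_eq, eval_eq, map_sum, Finset.mul_sum]
  refine Finset.sum_congr rfl fun s hs ↦ ?_
  have hdeg : s.degree = n := by
    by_contra h
    exact mem_support_iff.mp hs (hg.coeff_eq_zero h)
  simp only [mul_pow, Finset.prod_mul_distrib, Finset.prod_pow_eq_pow_sum, map_mul, map_prod,
    map_pow, ← hdeg, Finsupp.degree_apply]
  ring

theorem IsHomogeneous.aeval_mem_pow {σ K A : Type*} [CommRing K] [CommRing A] [Algebra K A]
    {n : ℕ} {g : MvPolynomial σ K} (hg : g.IsHomogeneous n) {p : σ → A} {I : Ideal A}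
    (hp : ∀ i, p i ∈ I) : MvPolynomial.aeval p g ∈ I ^ n := by
  rw [aeval_def, eval₂_eq]
  refine Ideal.sum_mem _ fun s hs ↦ Ideal.mul_mem_left _ _ ?_
  have hdeg : s.degree = n := by
    by_contra h
    exact mem_support_iff.mp hs (hg.coeff_eq_zero h)
  rw [← hdeg, Finsupp.degree_apply, ← Finset.prod_pow_eq_pow_sum]
  exact Ideal.prod_mem_prod fun i _ ↦ Ideal.pow_mem_pow (hp i) _

theorem aeval_sub_aeval_mem {σ K A : Type*} [CommRing K] [CommRing A] [Algebra K A]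
    (g : MvPolynomial σ K) {p q : σ → A} {J : Ideal A} (h : ∀ i, p i - q i ∈ J) :
    aeval p g - aeval q g ∈ J := by
  rw [← Ideal.Quotient.mk_eq_mk_iff_sub_mem, ← Ideal.Quotient.mkₐ_eq_mk K,
    ← AlgHom.comp_apply, ← AlgHom.comp_apply, comp_aeval, comp_aeval]
  congr 2
  funext i
  exact (Ideal.Quotient.mk_eq_mk_iff_sub_mem _ _).mpr (h i)

theorem eq_zero_of_isSumSq_add_eq_zero {σ : Type*} {h F : MvPolynomial σ ℝ} (hF : IsSumSq F)
    (h0 : h * h + F = 0) : h = 0 := by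
  refine MvPolynomial.funext fun x ↦ ?_
  have hx : eval x h * eval x h + eval x F = 0 := by
    rw [← map_mul, ← map_add, h0, map_zero]
  have hFx : 0 ≤ eval x F := (hF.map_ringHom (eval x)).nonneg
  rw [map_zero]
  exact mul_self_eq_zero.mp (by nlinarith [mul_self_nonneg (eval x h)])

end MvPolynomial

open MvPolynomial

section RegularSystemOfParameters

variable {K A : Type*} [Field K] [CommRing A] [IsLocalRing A] [Algebra K A]
  {d : ℕ} {p : Fin d → A}

theorem not_maximalIdeal_le_radical_span [IsNoetherianRing A] (hdim : ringKrullDim A = d)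
    {s : Finset A} (hs : s.card < d) (hsm : Ideal.span (s : Set A) ≤ maximalIdeal A) :
    ¬ maximalIdeal A ≤ (Ideal.span (s : Set A)).radical := by
  intro hle
  have hmin : maximalIdeal A ∈ (Ideal.span (s : Set A)).minimalPrimes :=
    ⟨⟨inferInstance, hsm⟩, fun q hq _ ↦ hle.trans (hq.1.radical_le_iff.mpr hq.2)⟩
  have hht := Ideal.height_le_card_of_mem_minimalPrimes_span_finset hmin
  have hd := maximalIdeal_height_eq_ringKrullDim (R := A)
  rw [hdim] at hd
  have hd' : (maximalIdeal A).height = d := by exact_mod_cast hd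
  rw [hd'] at hht
  exact absurd (by exact_mod_cast hht : d ≤ s.card) (by omega)

theorem eq_zero_of_aeval_mem_maximalIdeal_pow_succ [Infinite K] [IsNoetherianRing A]
    (hdim : ringKrullDim A = d) (hp : Ideal.span (Set.range p) = maximalIdeal A)
    {n : ℕ} {g : MvPolynomial (Fin d) K} (hg : g.IsHomogeneous n)
    (hmem : aeval p g ∈ maximalIdeal A ^ (n + 1)) : g = 0 := by
  classical
  by_contra hne
  obtain ⟨c, hc⟩ : ∃ c, eval c g ≠ 0 := by
    by_contra! h
    exact hne (MvPolynomial.funext fun x ↦ by rw [h x, map_zero])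
  have hpm (i) : p i ∈ maximalIdeal A := hp ▸ Ideal.subset_span ⟨i, rfl⟩
  have hunit : IsUnit (algebraMap K A (eval c g)) := (IsUnit.mk0 _ hc).map _
  by_cases hc0 : ∀ i, c i = 0
  · have h := hg.aeval_mul_algebraMap (0 : K) c
    obtain rfl : n = 0 := by
      by_contra hn
      have hz : (fun i ↦ (0 : K) * algebraMap K K (c i)) = c := by funext i; simp [hc0 i]
      rw [hz, zero_pow hn, zero_mul] at h
      exact hc h
    have h' := aeval_sub_aeval_mem g (p := p) (q := fun i ↦ 1 * algebraMap K A (c i))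
      (J := maximalIdeal A) (fun i ↦ by simpa [hc0 i] using hpm i)
    rw [hg.aeval_mul_algebraMap, pow_zero, one_mul] at h'
    have := Ideal.sub_mem _ (pow_one (maximalIdeal A) ▸ hmem) h'
    rw [sub_sub_cancel] at this
    exact (mem_maximalIdeal _).mp this hunit
  push Not at hc0
  obtain ⟨i₀, hi₀⟩ := hc0
  obtain ⟨t, ht⟩ : ∃ t : A, t = algebraMap K A (c i₀)⁻¹ * p i₀ := ⟨_, rfl⟩
  have htm : t ∈ maximalIdeal A := ht ▸ Ideal.mul_mem_left _ _ (hpm i₀)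
  let q : Fin d → A := fun i ↦ p i - t * algebraMap K A (c i)
  have hq₀ : q i₀ = 0 := by
    have : algebraMap K A (c i₀)⁻¹ * algebraMap K A (c i₀) = 1 := by
      rw [← map_mul, inv_mul_cancel₀ hi₀, map_one]
    simp only [q, ht]
    linear_combination -p i₀ * this
  let s : Finset A := (Finset.univ.erase i₀).image q
  let J : Ideal A := Ideal.span (s : Set A)
  have hs : s.card < d := by
    have h1 : s.card ≤ (Finset.univ.erase i₀).card := Finset.card_image_le
    rw [Finset.card_erase_of_mem (Finset.mem_univ _), Finset.card_univ, Fintype.card_fin] at h1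
    have := i₀.pos
    omega
  have hqJ (i) : q i ∈ J := by
    by_cases hi : i = i₀
    · rw [hi, hq₀]; exact J.zero_mem
    · exact Ideal.subset_span (by
        simpa [s] using ⟨i, hi, rfl⟩)
  have hJm : J ≤ maximalIdeal A := by
    refine Ideal.span_le.mpr fun x hx ↦ ?_
    obtain ⟨i, -, rfl⟩ := Finset.mem_image.mp (Finset.mem_coe.mp hx)
    exact Ideal.sub_mem _ (hpm i) (Ideal.mul_mem_right _ _ htm)
  have hmap : (maximalIdeal A).map (Ideal.Quotient.mk J) ≤
      Ideal.span {Ideal.Quotient.mk J t} := by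
    rw [← hp, Ideal.map_span, Ideal.span_le]
    rintro _ ⟨_, ⟨i, rfl⟩, rfl⟩
    rw [(Ideal.Quotient.mk_eq_mk_iff_sub_mem _ _).mpr (hqJ i), map_mul]
    exact Ideal.mul_mem_right _ _ (Ideal.mem_span_singleton_self _)
  have hpow : Ideal.Quotient.mk J (aeval p g) ∈ Ideal.span {Ideal.Quotient.mk J t ^ (n + 1)} := by
    rw [← Ideal.span_singleton_pow]
    refine Ideal.pow_right_mono hmap _ ?_
    rw [← Ideal.map_pow]
    exact Ideal.mem_map_of_mem _ hmem
  have hsub : aeval p g - t ^ n * algebraMap K A (eval c g) ∈ J := by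
    rw [← hg.aeval_mul_algebraMap]
    exact aeval_sub_aeval_mem g hqJ
  obtain ⟨a', ha'⟩ := Ideal.mem_span_singleton'.mp hpow
  obtain ⟨a, rfl⟩ := Ideal.Quotient.mk_surjective a'
  rw [← map_pow, ← map_mul, Ideal.Quotient.mk_eq_mk_iff_sub_mem] at ha'
  have hu : IsUnit (algebraMap K A (eval c g) - t * a) := by
    by_contra h
    have := Ideal.add_mem _ ((mem_maximalIdeal _).mpr h) (Ideal.mul_mem_right a _ htm)
    rw [sub_add_cancel] at this
    exact (mem_maximalIdeal _).mp this hunit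
  have htn : t ^ n ∈ J := by
    rw [← Ideal.mul_unit_mem_iff_mem J hu]
    convert J.neg_mem (J.add_mem ha' hsub) using 1
    ring
  refine not_maximalIdeal_le_radical_span hdim hs hJm ?_
  rw [← hp, Ideal.span_le]
  rintro _ ⟨i, rfl⟩
  have h1 : q i ∈ J.radical := Ideal.le_radical (hqJ i)
  have h2 : t ∈ J.radical := ⟨n, htn⟩
  have := J.radical.add_mem h1 (J.radical.mul_mem_right (algebraMap K A (c i)) h2)
  simpa [q] using this

theorem exists_sub_algebraMap_mem_maximalIdeal
    (hres : Function.Surjective (algebraMap K (A ⧸ maximalIdeal A))) (a : A) :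
    ∃ r : K, a - algebraMap K A r ∈ maximalIdeal A := by
  obtain ⟨r, hr⟩ := hres (Ideal.Quotient.mk _ a)
  exact ⟨r, (Ideal.Quotient.mk_eq_mk_iff_sub_mem _ _).mp hr.symm⟩

theorem exists_isHomogeneous_sub_aeval_mem
    (hres : Function.Surjective (algebraMap K (A ⧸ maximalIdeal A)))
    (hp : Ideal.span (Set.range p) = maximalIdeal A) (n : ℕ) {a : A}
    (ha : a ∈ maximalIdeal A ^ n) :
    ∃ h : MvPolynomial (Fin d) K, h.IsHomogeneous n ∧ a - aeval p h ∈ maximalIdeal A ^ (n + 1) := by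
  induction n generalizing a with
  | zero =>
    obtain ⟨r, hr⟩ := exists_sub_algebraMap_mem_maximalIdeal hres a
    exact ⟨C r, isHomogeneous_C _ r, by simpa using hr⟩
  | succ n ih =>
    have hpm (i) : p i ∈ maximalIdeal A := hp ▸ Ideal.subset_span ⟨i, rfl⟩
    rw [pow_succ'] at ha
    refine Submodule.mul_induction_on ha (fun x hx y hy ↦ ?_) ?_
    · obtain ⟨h, hh, hmem⟩ := ih hy
      obtain ⟨u, rfl⟩ := Ideal.mem_span_range_iff_exists_fun.mp (hp ▸ hx)
      choose r hr using fun i ↦ exists_sub_algebraMap_mem_maximalIdeal hres (u i)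
      refine ⟨(∑ i, C (r i) * X i) * h, ?_, ?_⟩
      · rw [add_comm]
        exact (IsHomogeneous.sum _ _ _ fun i _ ↦ isHomogeneous_C_mul_X _ _).mul hh
      · have h1 : (∑ i, u i * p i) - ∑ i, algebraMap K A (r i) * p i ∈ maximalIdeal A ^ 2 := by
          rw [← Finset.sum_sub_distrib, pow_two]
          refine Ideal.sum_mem _ fun i _ ↦ ?_
          rw [← sub_mul]
          exact Ideal.mul_mem_mul (hr i) (hpm i)
        have h2 := Ideal.mul_mem_mul h1 hy
        have h3 : (∑ i, algebraMap K A (r i) * p i) * (y - aeval p h) ∈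
            maximalIdeal A * maximalIdeal A ^ (n + 1) :=
          Ideal.mul_mem_mul (Ideal.sum_mem _ fun i _ ↦ Ideal.mul_mem_left _ _ (hpm i)) hmem
        rw [← pow_add, add_comm 2 n] at h2
        rw [← pow_succ'] at h3
        convert Ideal.add_mem _ h2 h3 using 1
        simp only [map_mul, map_sum, aeval_X, algHom_C]
        ring
    · rintro x y ⟨h, hh, hmem⟩ ⟨h', hh', hmem'⟩
      refine ⟨h + h', hh.add hh', ?_⟩
      convert Ideal.add_mem _ hmem hmem' using 1
      rw [map_add]
      ring

theorem exists_initialForm_le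
    (hres : Function.Surjective (algebraMap K (A ⧸ maximalIdeal A)))
    (hp : Ideal.span (Set.range p) = maximalIdeal A) (a : A) (j : ℕ) :
    ∃ i ≤ j, ∃ h : MvPolynomial (Fin d) K, h.IsHomogeneous i ∧
      a - aeval p h ∈ maximalIdeal A ^ (i + 1) ∧ (h ≠ 0 ∨ i = j) := by
  induction j with
  | zero =>
    obtain ⟨h, hh, hmem⟩ := exists_isHomogeneous_sub_aeval_mem hres hp 0 (a := a) (by simp)
    exact ⟨0, le_rfl, h, hh, hmem, .inr rfl⟩
  | succ j ih =>
    obtain ⟨i, hij, h, hh, hmem, hor⟩ := ih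
    by_cases h0 : h = 0
    · obtain rfl : i = j := hor.resolve_left (not_not.mpr h0)
      rw [h0, map_zero, sub_zero] at hmem
      obtain ⟨h', hh', hmem'⟩ := exists_isHomogeneous_sub_aeval_mem hres hp _ hmem
      exact ⟨i + 1, le_rfl, h', hh', hmem', .inr rfl⟩
    · exact ⟨i, by omega, h, hh, hmem, .inl h0⟩

theorem IsSumSq.exists_initialForm_le [Algebra ℝ A]
    (hres : Function.Surjective (algebraMap ℝ (A ⧸ maximalIdeal A)))
    (hp : Ideal.span (Set.range p) = maximalIdeal A) {a : A} (ha : IsSumSq a) (j : ℕ) :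
    ∃ i ≤ j, ∃ F : MvPolynomial (Fin d) ℝ, IsSumSq F ∧ F.IsHomogeneous (2 * i) ∧
      a - aeval p F ∈ maximalIdeal A ^ (2 * i + 1) ∧ (F ≠ 0 ∨ i = j) := by
  have hpm (i) : p i ∈ maximalIdeal A := hp ▸ Ideal.subset_span ⟨i, rfl⟩
  induction ha with
  | zero => exact ⟨j, le_rfl, 0, .zero, isHomogeneous_zero _ _ _, by simp, .inr rfl⟩
  | sq_add b hs ih =>
    rename_i s
    obtain ⟨i, hij, F, hF, hFh, hFmem, hFor⟩ := ih
    obtain ⟨l, hlj, h, hh, hmem, hor⟩ := _root_.exists_initialForm_le hres hp b j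
    have hhh : (h * h).IsHomogeneous (2 * l) := two_mul l ▸ hh.mul hh
    have hsq : b * b - aeval p (h * h) ∈ maximalIdeal A ^ (2 * l + 1) := by
      have h1 := hh.aeval_mem_pow hpm
      have h2 : b + aeval p h ∈ maximalIdeal A ^ l := by
        convert Ideal.add_mem _ (Ideal.pow_le_pow_right (Nat.le_succ l) hmem)
          (Ideal.add_mem _ h1 h1) using 1
        ring
      have h3 := Ideal.mul_mem_mul hmem h2
      rw [← pow_add, (by ring : l + 1 + l = 2 * l + 1)] at h3
      convert h3 using 1
      rw [map_mul]
      ring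
    rcases lt_trichotomy i l with hil | rfl | hli
    · refine ⟨i, hij, F, hF, hFh, ?_, hFor⟩
      have h1 := Ideal.pow_le_pow_right (by omega : 2 * i + 1 ≤ 2 * l + 1) hsq
      have h2 := Ideal.pow_le_pow_right (by omega : 2 * i + 1 ≤ 2 * l) (hhh.aeval_mem_pow hpm)
      convert Ideal.add_mem _ (Ideal.add_mem _ h1 h2) hFmem using 1
      ring
    · refine ⟨i, hij, h * h + F, .sq_add h hF, hhh.add hFh, ?_, ?_⟩
      · convert Ideal.add_mem _ hsq hFmem using 1
        rw [map_add]
        ring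
      · exact hor.imp_left fun hne h0 ↦ hne (eq_zero_of_isSumSq_add_eq_zero hF h0)
    · refine ⟨l, hlj, h * h, .mul_self h, hhh, ?_, hor.imp_left fun hne ↦ mul_ne_zero hne hne⟩
      have h1 := Ideal.pow_le_pow_right (by omega : 2 * l + 1 ≤ 2 * i + 1) hFmem
      have h2 := Ideal.pow_le_pow_right (by omega : 2 * l + 1 ≤ 2 * i) (hFh.aeval_mem_pow hpm)
      convert Ideal.add_mem _ (Ideal.add_mem _ h1 h2) hsq using 1
      ring

end RegularSystemOfParameters


/-- Let `A` be a regular local `ℝ`-algebra with residue field `ℝ`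
(a Noetherian local ring whose maximal ideal is generated by a regular system of
parameters `p₁, …, p_d` with `d = dim A`). If `f ∈ ℝ[x₁,…,x_d]` is a homogeneous
polynomial that is not a sum of squares, then `f(p₁,…,p_d)` is not a sum of squares
in `A`. -/
theorem not_isSumSq_aeval_regularSystemOfParameters
    (A : Type) [CommRing A] [IsNoetherianRing A] [IsLocalRing A] [Algebra ℝ A]
    (hres : Function.Bijective (algebraMap ℝ (A ⧸ IsLocalRing.maximalIdeal A)))
    (d : ℕ) (hdim : ringKrullDim A = d)
    (p : Fin d → A) (hp : Ideal.span (Set.range p) = IsLocalRing.maximalIdeal A)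
    (k : ℕ) (f : MvPolynomial (Fin d) ℝ) (hf : f.IsHomogeneous k)
    (hnsos : ¬ IsSumSq f) :
    ¬ IsSumSq (MvPolynomial.aeval p f) := by
  intro hsos
  have hpm (i) : p i ∈ maximalIdeal A := hp ▸ Ideal.subset_span ⟨i, rfl⟩
  obtain ⟨i, hik, F, hF, hFh, hmem, hor⟩ := hsos.exists_initialForm_le hres.2 hp k
  have hfk := hf.aeval_mem_pow hpm
  rcases lt_trichotomy (2 * i) k with hlt | rfl | hgt
  · have hFmem : aeval p F ∈ maximalIdeal A ^ (2 * i + 1) := by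
      have h1 := Ideal.pow_le_pow_right (by omega : 2 * i + 1 ≤ k) hfk
      simpa only [sub_sub_cancel] using Ideal.sub_mem _ h1 hmem
    have hF0 := eq_zero_of_aeval_mem_maximalIdeal_pow_succ hdim hp hFh hFmem
    exact hor.elim (· hF0) (by omega)
  · rw [← map_sub] at hmem
    have h0 := eq_zero_of_aeval_mem_maximalIdeal_pow_succ hdim hp (hf.sub hFh) hmem
    exact hnsos (sub_eq_zero.mp h0 ▸ hF)
  · have hfmem : aeval p f ∈ maximalIdeal A ^ (k + 1) := by
      have h1 := Ideal.pow_le_pow_right (by omega : k + 1 ≤ 2 * i + 1) hmem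
      have h2 := Ideal.pow_le_pow_right (by omega : k + 1 ≤ 2 * i) (hFh.aeval_mem_pow hpm)
      simpa using Ideal.add_mem _ h1 h2
    exact hnsos (eq_zero_of_aeval_mem_maximalIdeal_pow_succ hdim hp hf hfmem ▸ .zero)
end

section
/- Let A be a commutative ℝ-algebra, let ξ : A → ℝ be an ℝ-algebra homomorphism with kernel m ⊆ A, and let B be any commutative ℝ-algebra. Let M ⊆ A ⊗_ℝ B denote the kernel of the induced B-algebra homomorphism ξ ⊗ id : A ⊗_ℝ B → B. Then for every integer N ≥ 1, the natural B-algebra homomorphism (A/m^N) ⊗_ℝ B → (A ⊗_ℝ B)/M^N is an isomorphism. -/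
/-- The kernel of `ξ ⊗ id : A ⊗[R] B → B` is the extension of the kernel of `ξ : A → R`. -/
theorem ker_lid_comp_map_id {R A B : Type*} [CommRing R] [CommRing A] [Algebra R A]
    [CommRing B] [Algebra R B] (ξ : A →ₐ[R] R) :
    RingHom.ker ((Algebra.TensorProduct.lid R B).toAlgHom.comp
        (Algebra.TensorProduct.map ξ (AlgHom.id R B))) =
      (RingHom.ker ξ).map (algebraMap A (TensorProduct R A B)) := by
  have hξ : Function.Surjective ξ := fun r ↦ ⟨algebraMap R A r, ξ.commutes r⟩
  refine Eq.trans ?_ (Algebra.TensorProduct.rTensor_ker (C := B) ξ hξ)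
  ext x
  simp [RingHom.mem_ker]

/-- For an `ℝ`-algebra homomorphism `ξ : A → ℝ` with kernel `m`, a commutative
`ℝ`-algebra `B`, and `M` the kernel of the induced homomorphism `ξ ⊗ id : A ⊗ℝ B → B`, the
natural map `(A/m^N) ⊗ℝ B → (A ⊗ℝ B)/M^N` is an isomorphism for every `N ≥ 1`. -/
theorem tensor_quotient_power_iso
    (A : Type) [CommRing A] [Algebra ℝ A]
    (B : Type) [CommRing B] [Algebra ℝ B]
    (ξ : A →ₐ[ℝ] ℝ) (m : Ideal A) (hm : m = RingHom.ker (ξ : A →+* ℝ))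
    (φ : TensorProduct ℝ A B →ₐ[ℝ] B)
    (hφ : φ = (Algebra.TensorProduct.lid ℝ B).toAlgHom.comp
        (Algebra.TensorProduct.map ξ (AlgHom.id ℝ B)))
    (M : Ideal (TensorProduct ℝ A B)) (hM : M = RingHom.ker (φ : TensorProduct ℝ A B →+* B))
    (N : ℕ) (hN : 1 ≤ N) :
    ∃ e : TensorProduct ℝ (A ⧸ m ^ N) B ≃ₐ[ℝ] (TensorProduct ℝ A B ⧸ M ^ N),
      ∀ (a : A) (b : B),
        e (TensorProduct.tmul ℝ (Ideal.Quotient.mk (m ^ N) a) b) =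
          Ideal.Quotient.mk (M ^ N) (TensorProduct.tmul ℝ a b) := by
  have hMm : (m ^ N).map (algebraMap A (TensorProduct ℝ A B)) = M ^ N := by
    rw [Ideal.map_pow, hM, hm, hφ]
    exact congrArg (· ^ N) (ker_lid_comp_map_id ξ).symm
  refine ⟨(Algebra.TensorProduct.quotientTensorEquiv ℝ B A (m ^ N)).trans
    (Ideal.quotientEquivAlgOfEq ℝ hMm), fun a b ↦ ?_⟩
  rfl
end
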